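/- Let n ≥ 1 and s > 0, and let μ be a Radon measure on (ℍ^n, d_H) such that the set of points x for which the s-density Θ^s(μ,x) = lim_{r→0⁺} μ(B(x,r))/r^s exists and is positive and finite has positive μ-measure. Then s is an integer. -/

import Mathlib

open MeasureTheory Set Filter ENNReal NNReal

noncomputable section

/-- The underlying space of the Heisenberg group `ℍⁿ = ℝ²ⁿ × ℝ`. -/
abbrev Heis (n : ℕ) := EuclideanSpace ℝ (Fin (2 * n)) × ℝ

/-- The symplectic form `A(x',y') = -2 ∑ (x_j y_{j+n} - x_{j+n} y_j)` on `ℝ²ⁿ`. -/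
def symp {n : ℕ} (x y : EuclideanSpace ℝ (Fin (2 * n))) : ℝ :=
  -2 * ∑ j : Fin n,
    (x ⟨j.1, by have := j.isLt; omega⟩ * y ⟨j.1 + n, by have := j.isLt; omega⟩ -
     x ⟨j.1 + n, by have := j.isLt; omega⟩ * y ⟨j.1, by have := j.isLt; omega⟩)

/-- The Heisenberg group multiplication. -/
def hmul {n : ℕ} (x y : Heis n) : Heis n := (x.1 + y.1, x.2 + y.2 + symp x.1 y.1)

/-- The Heisenberg group inverse, `x⁻¹ = -x`. -/
def hinv {n : ℕ} (x : Heis n) : Heis n := (-x.1, -x.2)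

/-- The identity element `e = 0`. -/
def eH {n : ℕ} : Heis n := (0, 0)

/-- The Korányi norm `‖x‖_H = (|x'|⁴ + x_{2n+1}²)^{1/4}`. -/
def KNorm {n : ℕ} (x : Heis n) : ℝ := (‖x.1‖ ^ 4 + x.2 ^ 2) ^ ((1 : ℝ) / 4)

/-- The Korányi metric `d_H(x,y) = ‖x⁻¹·y‖_H`. -/
def dH {n : ℕ} (x y : Heis n) : ℝ := KNorm (hmul (hinv x) y)

/-- The closed `d_H`-ball of center `x` and radius `r`. -/
def ballH {n : ℕ} (x : Heis n) (r : ℝ) : Set (Heis n) := {y | dH x y ≤ r}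

/-- The support of a measure with respect to the Korányi metric. -/
def suppH {n : ℕ} (μ : Measure (Heis n)) : Set (Heis n) := {x | ∀ r > 0, 0 < μ (ballH x r)}

/-- A Radon measure is uniformly distributed if all balls centered on its support of
a common radius have the same measure. -/
def UniformlyDistributed {n : ℕ} (μ : Measure (Heis n)) : Prop :=
  ∀ x ∈ suppH μ, ∀ y ∈ suppH μ, ∀ r : ℝ, 0 < r → μ (ballH x r) = μ (ballH y r)

/-- The dilations `δ_r(x', x_{2n+1}) = (r x', r² x_{2n+1})`. -/
def dil {n : ℕ} (r : ℝ) (x : Heis n) : Heis n := (r • x.1, r ^ 2 * x.2)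

/-- `d_H`-diameter of a set, as an extended real. -/
def ediamH {n : ℕ} (E : Set (Heis n)) : ℝ≥0∞ :=
  ⨆ x ∈ E, ⨆ y ∈ E, ENNReal.ofReal (dH x y)

/-- The `s`-dimensional Hausdorff measure built from the Korányi metric `d_H`. -/
def hausH {n : ℕ} (s : ℝ) (E : Set (Heis n)) : ℝ≥0∞ :=
  ⨆ (δ : ℝ) (_ : 0 < δ), ⨅ (t : ℕ → Set (Heis n)) (_ : E ⊆ ⋃ i, t i)
    (_ : ∀ i, ediamH (t i) ≤ ENNReal.ofReal δ), ∑' i, ediamH (t i) ^ s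

/-- The Hausdorff dimension with respect to the Korányi metric `d_H`. -/
def dimHH {n : ℕ} (E : Set (Heis n)) : ℝ≥0∞ :=
  ⨆ (d : ℝ≥0) (_ : hausH (d : ℝ) E = ⊤), (d : ℝ≥0∞)

/-- `Θˢ(μ,x) = d`: the `s`-density of `μ` at `x` exists and equals `d`. -/
def HasDensity {n : ℕ} (μ : Measure (Heis n)) (s : ℝ) (x : Heis n) (d : ℝ≥0∞) : Prop :=
  Tendsto (fun r : ℝ => μ (ballH x r) / ENNReal.ofReal (r ^ s)) (nhdsWithin 0 (Ioi 0)) (nhds d)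


open scoped Topology RealInnerProductSpace ContDiff

/-- Horizontal layer. -/
abbrev EE (n : ℕ) := EuclideanSpace ℝ (Fin (2 * n))

lemma sum_split (n : ℕ) (f : Fin (2 * n) → ℝ) :
    ∑ i, f i = ∑ j : Fin n, (f ⟨j.1, by have := j.isLt; omega⟩ +
      f ⟨j.1 + n, by have := j.isLt; omega⟩) := by
  rw [Finset.sum_add_distrib]
  have h : n + n = 2 * n := by omega
  rw [← Equiv.sum_comp (finCongr h) f, Fin.sum_univ_add]
  congr 1
  refine Finset.sum_congr rfl fun j _ => ?_
  congr 1
  ext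
  simp [add_comm]

/-- The linear map representing the symplectic form. -/
def Jlin (n : ℕ) : EE n →ₗ[ℝ] EE n where
  toFun x := WithLp.toLp 2 fun i : Fin (2 * n) =>
    if h : i.1 < n then 2 * x ⟨i.1 + n, by omega⟩ else -2 * x ⟨i.1 - n, by omega⟩
  map_add' x y := by
    ext i
    by_cases h : i.1 < n <;> simp [h] <;> ring
  map_smul' c x := by
    ext i
    by_cases h : i.1 < n <;> simp [h] <;> ring

def JL (n : ℕ) : EE n →L[ℝ] EE n := LinearMap.toContinuousLinearMap (Jlin n)

lemma JL_lo {n : ℕ} (x : EE n) (j : Fin n) :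
    JL n x ⟨j.1, by have := j.isLt; omega⟩ = 2 * x ⟨j.1 + n, by have := j.isLt; omega⟩ := by
  simp [JL, Jlin]

lemma JL_hi {n : ℕ} (x : EE n) (j : Fin n) :
    JL n x ⟨j.1 + n, by have := j.isLt; omega⟩ = -2 * x ⟨j.1, by have := j.isLt; omega⟩ := by
  simp [JL, Jlin]

lemma symp_eq {n : ℕ} (x y : EE n) : symp x y = ⟪JL n x, y⟫ := by
  rw [PiLp.inner_apply, sum_split, symp, Finset.mul_sum]
  refine Finset.sum_congr rfl fun j _ => ?_
  simp only [JL_lo, JL_hi]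
  simp
  ring

lemma symp_self {n : ℕ} (x : EE n) : symp x x = 0 := by
  simp only [symp]
  rw [Finset.sum_eq_zero]
  · simp
  · intro j _; ring

lemma symp_add_left {n : ℕ} (x y z : EE n) : symp (x + y) z = symp x z + symp y z := by
  simp [symp_eq, inner_add_left]

lemma symp_add_right {n : ℕ} (x y z : EE n) : symp x (y + z) = symp x y + symp x z := by
  simp [symp_eq, inner_add_right]

lemma symp_smul_left {n : ℕ} (c : ℝ) (x z : EE n) : symp (c • x) z = c * symp x z := by
  simp [symp_eq, inner_smul_left]

lemma symp_smul_right {n : ℕ} (c : ℝ) (x z : EE n) : symp x (c • z) = c * symp x z := by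
  simp [symp_eq, inner_smul_right]

lemma symp_neg_left {n : ℕ} (x z : EE n) : symp (-x) z = - symp x z := by
  simp [symp_eq]

lemma symp_neg_right {n : ℕ} (x z : EE n) : symp x (-z) = - symp x z := by
  simp [symp_eq]

lemma symp_swap {n : ℕ} (x y : EE n) : symp y x = - symp x y := by
  have h := symp_self (x + y)
  rw [symp_add_left, symp_add_right, symp_add_right, symp_self, symp_self] at h
  linarith

lemma symp_zero_left {n : ℕ} (y : EE n) : symp 0 y = 0 := by simp [symp_eq]
lemma symp_zero_right {n : ℕ} (y : EE n) : symp y 0 = 0 := by simp [symp_eq]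

lemma norm_JL {n : ℕ} (x : EE n) : ‖JL n x‖ = 2 * ‖x‖ := by
  have h : ‖JL n x‖ ^ 2 = (2 * ‖x‖) ^ 2 := by
    rw [mul_pow, EuclideanSpace.norm_sq_eq, EuclideanSpace.norm_sq_eq, sum_split, sum_split,
      Finset.mul_sum]
    refine Finset.sum_congr rfl fun j _ => ?_
    rw [JL_lo, JL_hi]
    simp only [Real.norm_eq_abs, sq_abs]
    ring
  exact (pow_left_inj₀ (norm_nonneg _) (by positivity) two_ne_zero).1 h

lemma cs_ineq {n : ℕ} (x y : EE n) :
    (2 * ⟪x, y⟫) ^ 2 + symp x y ^ 2 ≤ (2 * (‖x‖ * ‖y‖)) ^ 2 := by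
  set S := (2 * ⟪x, y⟫) ^ 2 + symp x y ^ 2 with hS
  set v : EE n := (4 * ⟪x, y⟫) • x + (symp x y) • JL n x with hv
  have h1 : ⟪v, y⟫ = S := by
    rw [hv, inner_add_left, inner_smul_left, inner_smul_left, ← symp_eq]
    simp
    ring
  have hx : ⟪JL n x, x⟫ = 0 := by rw [← symp_eq, symp_self]
  have h2 : ‖v‖ ^ 2 = 4 * ‖x‖ ^ 2 * S := by
    rw [hv, norm_add_sq_real, inner_smul_left, inner_smul_right, norm_smul, norm_smul, norm_JL,
      real_inner_comm (JL n x) x, hx]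
    simp only [Real.norm_eq_abs, mul_pow, sq_abs]
    simp only [hS]
    ring
  have h3 : S ≤ ‖v‖ * ‖y‖ := h1 ▸ real_inner_le_norm v y
  have hS0 : 0 ≤ S := by positivity
  have h4 : S ^ 2 ≤ (4 * ‖x‖ ^ 2 * S) * ‖y‖ ^ 2 := by
    rw [← h2, ← mul_pow]
    exact pow_le_pow_left₀ hS0 h3 2
  rcases hS0.eq_or_lt with h | h
  · rw [← h]; positivity
  · have : S * S ≤ S * ((2 * (‖x‖ * ‖y‖)) ^ 2) := by nlinarith
    exact le_of_mul_le_mul_left this h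

lemma abs_symp_le {n : ℕ} (x y : EE n) : |symp x y| ≤ 2 * (‖x‖ * ‖y‖) := by
  apply abs_le_of_sq_le_sq _ (by positivity)
  have := cs_ineq x y
  nlinarith [sq_nonneg (2 * ⟪x, y⟫)]

lemma KNorm_nonneg {n : ℕ} (x : Heis n) : 0 ≤ KNorm x := by unfold KNorm; positivity

lemma KNorm_pow {n : ℕ} (x : Heis n) : KNorm x ^ 4 = ‖x.1‖ ^ 4 + x.2 ^ 2 := by
  unfold KNorm
  rw [← Real.rpow_natCast, ← Real.rpow_mul (by positivity)]
  norm_num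

lemma KNorm_le_iff {n : ℕ} (x : Heis n) {r : ℝ} (hr : 0 ≤ r) :
    KNorm x ≤ r ↔ ‖x.1‖ ^ 4 + x.2 ^ 2 ≤ r ^ 4 := by
  rw [← KNorm_pow]
  exact (pow_le_pow_iff_left₀ (KNorm_nonneg x) hr (by norm_num)).symm

lemma norm_fst_le_KNorm {n : ℕ} (x : Heis n) : ‖x.1‖ ≤ KNorm x := by
  have h := KNorm_pow x
  exact (pow_le_pow_iff_left₀ (norm_nonneg _) (KNorm_nonneg x) (n := 4) (by norm_num)).1
    (by nlinarith [sq_nonneg x.2])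

lemma abs_snd_le_KNorm {n : ℕ} (x : Heis n) : |x.2| ≤ KNorm x ^ 2 := by
  have h := KNorm_pow x
  apply abs_le_of_sq_le_sq _ (by positivity)
  have : 0 ≤ ‖x.1‖ ^ 4 := by positivity
  nlinarith

lemma KNorm_sq_complex {n : ℕ} (x : Heis n) : KNorm x ^ 2 = ‖(⟨‖x.1‖ ^ 2, x.2⟩ : ℂ)‖ := by
  have h : (KNorm x ^ 2) ^ 2 = ‖(⟨‖x.1‖ ^ 2, x.2⟩ : ℂ)‖ ^ 2 := by
    rw [← pow_mul, KNorm_pow, ← Complex.normSq_eq_norm_sq, Complex.normSq_mk]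
    ring
  exact (pow_left_inj₀ (by positivity) (norm_nonneg _) two_ne_zero).1 h

lemma KNorm_hmul_le {n : ℕ} (x y : Heis n) : KNorm (hmul x y) ≤ KNorm x + KNorm y := by
  have ha := KNorm_nonneg x
  have hb := KNorm_nonneg y
  have key : KNorm (hmul x y) ^ 2 ≤ (KNorm x + KNorm y) ^ 2 := by
    rw [KNorm_sq_complex]
    have e : (⟨‖(hmul x y).1‖ ^ 2, (hmul x y).2⟩ : ℂ) = ⟨‖x.1‖ ^ 2, x.2⟩ + ⟨‖y.1‖ ^ 2, y.2⟩ +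
        ⟨2 * ⟪x.1, y.1⟫, symp x.1 y.1⟩ := by
      apply Complex.ext
      · simp only [hmul, Complex.add_re, norm_add_sq_real]; ring
      · simp [hmul]
    rw [e]
    have h3 : ‖(⟨2 * ⟪x.1, y.1⟫, symp x.1 y.1⟩ : ℂ)‖ ≤ 2 * (KNorm x * KNorm y) := by
      have h4 : ‖(⟨2 * ⟪x.1, y.1⟫, symp x.1 y.1⟩ : ℂ)‖ ≤ 2 * (‖x.1‖ * ‖y.1‖) := by
        refine (pow_le_pow_iff_left₀ (norm_nonneg _) (by positivity) two_ne_zero).1 ?_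
        rw [← Complex.normSq_eq_norm_sq, Complex.normSq_mk]
        have := cs_ineq x.1 y.1
        nlinarith
      have := mul_le_mul (norm_fst_le_KNorm x) (norm_fst_le_KNorm y) (norm_nonneg _) ha
      linarith
    have h5 := norm_add₃_le (a := (⟨‖x.1‖ ^ 2, x.2⟩ : ℂ)) (b := ⟨‖y.1‖ ^ 2, y.2⟩)
      (c := ⟨2 * ⟪x.1, y.1⟫, symp x.1 y.1⟩)
    rw [← KNorm_sq_complex, ← KNorm_sq_complex] at h5
    nlinarith
  exact (pow_le_pow_iff_left₀ (KNorm_nonneg _) (by positivity) two_ne_zero).1 key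

lemma hmul_assoc {n : ℕ} (x y z : Heis n) : hmul (hmul x y) z = hmul x (hmul y z) := by
  simp only [hmul, symp_add_left, symp_add_right]
  refine Prod.ext (add_assoc _ _ _) ?_
  simp only
  ring

lemma hinv_hmul_cancel {n : ℕ} (x y : Heis n) : hmul (hinv x) (hmul x y) = y := by
  simp only [hmul, hinv, symp_add_right, symp_neg_left, symp_self]
  refine Prod.ext (by simp) ?_
  simp only
  ring

lemma hmul_hinv_cancel {n : ℕ} (x y : Heis n) : hmul x (hmul (hinv x) y) = y := by
  simp only [hmul, hinv, symp_add_right, symp_neg_left, symp_neg_right, symp_self]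
  refine Prod.ext (by simp) ?_
  simp only
  ring

lemma hinv_hinv {n : ℕ} (x : Heis n) : hinv (hinv x) = x := by simp [hinv]

lemma hinv_hmul {n : ℕ} (x y : Heis n) : hinv (hmul x y) = hmul (hinv y) (hinv x) := by
  simp only [hmul, hinv, symp_neg_left, symp_neg_right]
  refine Prod.ext (by simp [add_comm]) ?_
  simp only
  rw [symp_swap y.1 x.1]
  ring

lemma KNorm_hinv {n : ℕ} (x : Heis n) : KNorm (hinv x) = KNorm x := by
  simp [KNorm, hinv]

lemma hmul_eH {n : ℕ} (x : Heis n) : hmul x eH = x := by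
  simp [hmul, eH, symp_zero_right]

lemma eH_hmul {n : ℕ} (x : Heis n) : hmul eH x = x := by
  simp [hmul, eH, symp_zero_left]

lemma KNorm_eH {n : ℕ} : KNorm (eH : Heis n) = 0 := by
  simp [KNorm, eH]

lemma hinv_hmul_self {n : ℕ} (x : Heis n) : hmul (hinv x) x = eH := by
  simp [hmul, hinv, symp_neg_left, symp_self, eH]

lemma dH_nonneg {n : ℕ} (x y : Heis n) : 0 ≤ dH x y := KNorm_nonneg _

lemma dH_self {n : ℕ} (x : Heis n) : dH x x = 0 := by
  rw [dH, hinv_hmul_self, KNorm_eH]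

lemma dH_comm {n : ℕ} (x y : Heis n) : dH x y = dH y x := by
  rw [dH, dH, ← KNorm_hinv, hinv_hmul, hinv_hinv]

lemma dH_triangle {n : ℕ} (x y z : Heis n) : dH x z ≤ dH x y + dH y z := by
  have : hmul (hinv x) z = hmul (hmul (hinv x) y) (hmul (hinv y) z) := by
    rw [hmul_assoc, hmul_hinv_cancel]
  rw [dH, this]
  exact KNorm_hmul_le _ _

lemma dH_left {n : ℕ} (a x y : Heis n) : dH (hmul a x) (hmul a y) = dH x y := by
  rw [dH, dH, hinv_hmul, hmul_assoc, hinv_hmul_cancel]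

lemma dH_eH {n : ℕ} (x : Heis n) : dH eH x = KNorm x := by
  simp [dH, hinv, eH, hmul, symp_zero_left]

lemma hinv_eH {n : ℕ} : hinv (eH : Heis n) = eH := by simp [hinv, eH]

lemma dH_hmul_right {n : ℕ} (x h : Heis n) : dH x (hmul x h) = KNorm h := by
  rw [dH, hinv_hmul_cancel]

lemma dil_hmul {n : ℕ} (r : ℝ) (x y : Heis n) : dil r (hmul x y) = hmul (dil r x) (dil r y) := by
  simp only [dil, hmul, symp_smul_left, symp_smul_right, smul_add]
  refine Prod.ext rfl ?_
  simp only
  ring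

lemma dil_hinv {n : ℕ} (r : ℝ) (x : Heis n) : dil r (hinv x) = hinv (dil r x) := by
  simp [dil, hinv]

lemma KNorm_dil {n : ℕ} {r : ℝ} (hr : 0 ≤ r) (x : Heis n) : KNorm (dil r x) = r * KNorm x := by
  have : KNorm (dil r x) ^ 4 = (r * KNorm x) ^ 4 := by
    rw [KNorm_pow, mul_pow, KNorm_pow]
    simp only [dil, norm_smul, Real.norm_eq_abs, mul_pow, abs_of_nonneg hr]
    ring
  exact (pow_left_inj₀ (KNorm_nonneg _) (mul_nonneg hr (KNorm_nonneg _)) (by norm_num)).1 this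

lemma dH_dil {n : ℕ} {r : ℝ} (hr : 0 ≤ r) (x y : Heis n) :
    dH (dil r x) (dil r y) = r * dH x y := by
  rw [dH, dH, ← dil_hinv, ← dil_hmul, KNorm_dil hr]

lemma dil_dil {n : ℕ} (r t : ℝ) (x : Heis n) : dil r (dil t x) = dil (r * t) x := by
  simp only [dil, smul_smul]
  refine Prod.ext rfl ?_
  simp only
  ring

lemma dil_one {n : ℕ} (x : Heis n) : dil 1 x = x := by simp [dil]

lemma dH_pow {n : ℕ} (x y : Heis n) :
    dH x y ^ 4 = (‖x.1 - y.1‖ ^ 2) ^ 2 + (y.2 - x.2 - symp x.1 y.1) ^ 2 := by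
  rw [dH, KNorm_pow]
  simp only [hmul, hinv, symp_neg_left]
  rw [norm_sub_rev, ← pow_mul]
  congr 1
  · congr 2; abel
  · ring

lemma continuous_symp {n : ℕ} : Continuous fun p : EE n × EE n => symp p.1 p.2 := by
  simp only [symp_eq]
  fun_prop

@[fun_prop]
lemma Continuous.symp' {n : ℕ} {X : Type*} [TopologicalSpace X] {f g : X → EE n}
    (hf : Continuous f) (hg : Continuous g) : Continuous fun x => symp (f x) (g x) :=
  continuous_symp.comp (hf.prodMk hg)

lemma continuous_KNorm {n : ℕ} : Continuous (KNorm : Heis n → ℝ) := by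
  unfold KNorm
  exact Continuous.rpow_const (by fun_prop) (fun x => Or.inr (by norm_num))

lemma continuous_hmul {n : ℕ} : Continuous fun p : Heis n × Heis n => hmul p.1 p.2 := by
  unfold hmul; fun_prop

lemma continuous_hinv {n : ℕ} : Continuous (hinv : Heis n → Heis n) := by
  unfold hinv; fun_prop

lemma continuous_dil {n : ℕ} (r : ℝ) : Continuous (dil r : Heis n → Heis n) := by
  unfold dil; fun_prop

lemma continuous_dH {n : ℕ} : Continuous fun p : Heis n × Heis n => dH p.1 p.2 := by
  unfold dH
  exact continuous_KNorm.comp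
    (continuous_hmul.comp ((continuous_hinv.comp continuous_fst).prodMk continuous_snd))

lemma continuous_hmul_left {n : ℕ} (x : Heis n) : Continuous fun y => hmul x y := by
  unfold hmul; fun_prop

lemma continuous_dH_right {n : ℕ} (x : Heis n) : Continuous fun y => dH x y := by
  unfold dH
  exact continuous_KNorm.comp (continuous_hmul_left _)

lemma isClosed_ballH {n : ℕ} (x : Heis n) (r : ℝ) : IsClosed (ballH x r) :=
  isClosed_le (continuous_dH_right x) continuous_const

lemma measurableSet_ballH {n : ℕ} (x : Heis n) (r : ℝ) : MeasurableSet (ballH x r) :=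
  (isClosed_ballH x r).measurableSet

lemma mem_ballH {n : ℕ} {x y : Heis n} {r : ℝ} : y ∈ ballH x r ↔ dH x y ≤ r := Iff.rfl

lemma ballH_subset {n : ℕ} {x y : Heis n} {r t : ℝ} (h : dH y x + r ≤ t) :
    ballH x r ⊆ ballH y t := fun z hz =>
  (dH_triangle y x z).trans (by have : dH x z ≤ r := hz; linarith)

lemma isCompact_ballH {n : ℕ} (x : Heis n) (r : ℝ) : IsCompact (ballH x r) := by
  have h1 : IsCompact (ballH (eH : Heis n) (KNorm x + r)) := by
    refine Metric.isCompact_of_isClosed_isBounded (isClosed_ballH _ _) ?_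
    refine (Metric.isBounded_closedBall (x := (0 : Heis n))
      (r := max (KNorm x + r) ((KNorm x + r) ^ 2))).subset fun y hy => ?_
    have hy' : KNorm y ≤ KNorm x + r := by rw [← dH_eH]; exact hy
    rw [mem_closedBall_zero_iff, Prod.norm_def]
    apply max_le_max
    · exact (norm_fst_le_KNorm y).trans hy'
    · exact (abs_snd_le_KNorm y).trans (pow_le_pow_left₀ (KNorm_nonneg _) hy' 2)
  refine h1.of_isClosed_subset (isClosed_ballH _ _) (ballH_subset ?_)
  rw [dH_eH]

lemma exists_ballH_subset {n : ℕ} (x : Heis n) {s : Set (Heis n)} (hs : s ∈ 𝓝 x) :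
    ∃ ε > 0, ballH x ε ⊆ s := by
  have h1 : (fun h => hmul x h) ⁻¹' s ∈ 𝓝 (0 : Heis n) := by
    apply (continuous_hmul_left x).continuousAt
    have : hmul x (0 : Heis n) = x := hmul_eH x
    simp only [this]
    exact hs
  obtain ⟨η, hη, h2⟩ := Metric.mem_nhds_iff.1 h1
  refine ⟨min (η / 2) 1, by positivity, fun y hy => ?_⟩
  have h3 : hmul (hinv x) y ∈ Metric.ball (0 : Heis n) η := by
    have hk : KNorm (hmul (hinv x) y) ≤ min (η / 2) 1 := hy
    have hk1 := hk.trans (min_le_left _ _)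
    have hk2 := hk.trans (min_le_right _ _)
    have h0 := KNorm_nonneg (hmul (hinv x) y)
    rw [mem_ball_zero_iff, Prod.norm_def]
    apply max_lt
    · linarith [norm_fst_le_KNorm (hmul (hinv x) y)]
    · have := abs_snd_le_KNorm (hmul (hinv x) y)
      rw [Real.norm_eq_abs]
      nlinarith
  have := h2 h3
  simpa [hmul_hinv_cancel] using this

lemma ballH_mem_nhds {n : ℕ} (x : Heis n) {r : ℝ} (hr : 0 < r) : ballH x r ∈ 𝓝 x := by
  have : {y | dH x y < r} ∈ 𝓝 x :=
    (isOpen_lt (continuous_dH_right x) continuous_const).mem_nhds (by simp [dH_self, hr])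
  exact mem_of_superset this fun y hy => le_of_lt (show dH x y < r from hy)

lemma tendsto_of_dH {n : ℕ} {k : ℕ → Heis n} {y : Heis n}
    (h : Tendsto (fun m => dH y (k m)) atTop (𝓝 0)) : Tendsto k atTop (𝓝 y) := by
  rw [tendsto_def]
  intro s hs
  obtain ⟨ε, hε, h2⟩ := exists_ballH_subset y hs
  filter_upwards [h.eventually (gt_mem_nhds hε)] with m hm
  exact h2 hm.le

lemma measure_compl_suppH {n : ℕ} (ν : Measure (Heis n)) : ν (suppH ν)ᶜ = 0 := by
  refine measure_null_of_locally_null _ fun x hx => ?_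
  have : ∃ r > 0, ν (ballH x r) = 0 := by
    simpa [suppH] using hx
  obtain ⟨r, hr, h0⟩ := this
  exact ⟨_, mem_nhdsWithin_of_mem_nhds (ballH_mem_nhds x hr), h0⟩

lemma ballH_eq_dil {n : ℕ} (a x : Heis n) {r : ℝ} (hr : 0 < r) (ρ : ℝ) :
    (fun z => dil r⁻¹ (hmul (hinv a) z)) ⁻¹' ballH x ρ = ballH (hmul a (dil r x)) (ρ * r) := by
  ext z
  simp only [mem_preimage, mem_ballH]
  have h1 : dH x (dil r⁻¹ (hmul (hinv a) z)) = r⁻¹ * dH (hmul a (dil r x)) z := by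
    have hx : x = dil r⁻¹ (dil r x) := by rw [dil_dil, inv_mul_cancel₀ hr.ne', dil_one]
    conv_lhs => rw [hx]
    rw [dH_dil (by positivity), ← dH_left a, hmul_hinv_cancel]
  rw [h1, inv_mul_le_iff₀ hr, mul_comm]

open CompactlySupported in
/-- A cutoff function. -/
lemma exists_bump {n : ℕ} (x : Heis n) {r t : ℝ} (h : r < t) :
    ∃ g : C_c(Heis n, ℝ), (∀ y, 0 ≤ g y) ∧ (∀ y, g y ≤ 1) ∧ (∀ y ∈ ballH x r, g y = 1) ∧
      (∀ y, y ∉ ballH x t → g y = 0) ∧ tsupport g ⊆ ballH x t := by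
  let f : Heis n → ℝ := fun y => max 0 (min 1 ((t - dH x y) / (t - r)))
  have hf : Continuous f := by
    have := continuous_dH_right x
    fun_prop
  have hz : ∀ y, y ∉ ballH x t → f y = 0 := by
    intro y hy
    have hy' : t < dH x y := not_le.1 hy
    apply max_eq_left
    exact (min_le_right _ _).trans (div_nonpos_of_nonpos_of_nonneg (by linarith) (by linarith))
  have hsupp : Function.support f ⊆ ballH x t := by
    intro y hy
    by_contra h'
    exact hy (hz y h')
  have hts : tsupport f ⊆ ballH x t := closure_minimal hsupp (isClosed_ballH _ _)
  have hc : HasCompactSupport f := (isCompact_ballH x t).of_isClosed_subset isClosed_closure hts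
  refine ⟨⟨⟨f, hf⟩, hc⟩, fun y => le_max_left _ _, fun y => max_le zero_le_one (min_le_left _ _),
    fun y hy => ?_, hz, hts⟩
  have hy' : dH x y ≤ r := hy
  change max 0 (min 1 ((t - dH x y) / (t - r))) = 1
  rw [min_eq_left, max_eq_right zero_le_one]
  rw [le_div_iff₀ (by linarith)]
  linarith

open CompactlySupported in
lemma exists_lim {n : ℕ} (μ : ℕ → Measure (Heis n)) [∀ j, IsFiniteMeasureOnCompacts (μ j)]
    (U : Ultrafilter ℕ)
    (hb : ∀ R : ℝ, ∃ C : ℝ, ∀ᶠ j in U, μ j (ballH eH R) ≤ ENNReal.ofReal C) (f : C_c(Heis n, ℝ)) :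
    ∃ l : ℝ, Tendsto (fun j => ∫ x, f x ∂(μ j)) U (𝓝 l) := by
  obtain ⟨K, hK⟩ := f.continuous.bounded_above_of_compact_support f.hasCompactSupport
  obtain ⟨R, hR⟩ : ∃ R : ℝ, tsupport f ⊆ ballH (eH : Heis n) R := by
    obtain ⟨R, hR⟩ := (f.hasCompactSupport.image (continuous_KNorm (n := n))).isBounded.subset_closedBall 0
    refine ⟨R, fun y hy => ?_⟩
    have := hR (mem_image_of_mem KNorm hy)
    rw [mem_closedBall_zero_iff, Real.norm_eq_abs] at this
    rw [mem_ballH, dH_eH]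
    exact (le_abs_self _).trans this
  obtain ⟨C, hC⟩ := hb R
  have hbd : ∀ᶠ j in U, (∫ x, f x ∂(μ j)) ∈ Metric.closedBall (0 : ℝ) (K * max C 0) := by
    filter_upwards [hC] with j hj
    rw [mem_closedBall_zero_iff]
    have e : ∫ x in ballH eH R, f x ∂(μ j) = ∫ x, f x ∂(μ j) :=
      setIntegral_eq_integral_of_forall_compl_eq_zero fun x hx =>
        image_eq_zero_of_notMem_tsupport fun h => hx (hR h)
    rw [← e]
    have hlt : μ j (ballH eH R) < ⊤ := (isCompact_ballH _ _).measure_lt_top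
    refine (norm_setIntegral_le_of_norm_le_const hlt (fun x _ => hK x)).trans ?_
    have hK0 : 0 ≤ K := (norm_nonneg _).trans (hK eH)
    refine mul_le_mul_of_nonneg_left ?_ hK0
    rw [Measure.real]
    refine (ENNReal.toReal_mono ENNReal.ofReal_ne_top hj).trans ?_
    rw [ENNReal.toReal_ofReal']
  obtain ⟨l, -, hl⟩ := (isCompact_closedBall (0 : ℝ) (K * max C 0)).ultrafilter_le_nhds'
    (U.map fun j => ∫ x, f x ∂(μ j)) hbd
  exact ⟨l, hl⟩

open CompactlySupported in
lemma vague_limit {n : ℕ} (μ : ℕ → Measure (Heis n)) [∀ j, IsFiniteMeasureOnCompacts (μ j)]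
    (U : Ultrafilter ℕ)
    (hb : ∀ R : ℝ, ∃ C : ℝ, ∀ᶠ j in U, μ j (ballH eH R) ≤ ENNReal.ofReal C) :
    ∃ ν : Measure (Heis n),
      (∀ (x : Heis n) (r t M : ℝ), r < t → 0 ≤ M →
        (∀ᶠ j in U, μ j (ballH x t) ≤ ENNReal.ofReal M) → ν (ballH x r) ≤ ENNReal.ofReal M) ∧
      (∀ (x : Heis n) (r t M : ℝ), r < t →
        (∀ᶠ j in U, ENNReal.ofReal M ≤ μ j (ballH x r)) → ENNReal.ofReal M ≤ ν (ballH x t)) := by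
  choose L hL using exists_lim μ U hb
  let Λ₀ : C_c(Heis n, ℝ) →ₗ[ℝ] ℝ :=
    { toFun := L
      map_add' := fun f g => by
        refine tendsto_nhds_unique (hL (f + g)) (((hL f).add (hL g)).congr fun j => ?_)
        exact (integral_add f.integrable g.integrable).symm
      map_smul' := fun c f => by
        refine tendsto_nhds_unique (hL (c • f)) (((hL f).const_mul c).congr fun j => ?_)
        exact (integral_const_mul c _).symm }
  let Λ : C_c(Heis n, ℝ) →ₚ[ℝ] ℝ := PositiveLinearMap.mk₀ Λ₀ fun f hf =>
    ge_of_tendsto' (hL f) fun j => integral_nonneg hf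
  have hΛ : ∀ f, Λ f = L f := fun f => rfl
  refine ⟨RealRMK.rieszMeasure Λ, ?_, ?_⟩
  · intro x r t M hrt hM h
    obtain ⟨g, g0, g1, gr, gt, -⟩ := exists_bump x hrt
    refine (RealRMK.rieszMeasure_le_of_eq_one Λ g0 (isCompact_ballH x r) gr).trans ?_
    apply ENNReal.ofReal_le_ofReal
    rw [hΛ]
    refine le_of_tendsto (hL g) ?_
    filter_upwards [h] with j hj
    have e : ∫ y in ballH x t, g y ∂(μ j) = ∫ y, g y ∂(μ j) :=
      setIntegral_eq_integral_of_forall_compl_eq_zero gt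
    rw [← e]
    have hlt : μ j (ballH x t) < ⊤ := (isCompact_ballH _ _).measure_lt_top
    refine (Real.le_norm_self _).trans ((norm_setIntegral_le_of_norm_le_const (C := 1) hlt
      (fun y _ => ?_)).trans ?_)
    · rw [Real.norm_eq_abs, abs_of_nonneg (g0 y)]; exact g1 y
    · rw [one_mul, Measure.real]
      exact ENNReal.toReal_le_of_le_ofReal hM hj
  · intro x r t M hrt h
    obtain ⟨g, g0, g1, gr, -, gt⟩ := exists_bump x hrt
    refine le_trans ?_ (RealRMK.le_rieszMeasure_tsupport_subset Λ (fun y => ⟨g0 y, g1 y⟩) gt)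
    apply ENNReal.ofReal_le_ofReal
    rw [hΛ]
    refine ge_of_tendsto (hL g) ?_
    filter_upwards [h] with j hj
    have hlt : μ j (ballH x r) < ⊤ := (isCompact_ballH _ _).measure_lt_top
    have h1 : M ≤ (μ j (ballH x r)).toReal :=
      (ENNReal.ofReal_le_iff_le_toReal hlt.ne).1 hj
    refine h1.trans ?_
    have h2 : ∫ y in ballH x r, g y ∂(μ j) = (μ j (ballH x r)).toReal := by
      rw [setIntegral_congr_fun (measurableSet_ballH x r) gr]
      simp [Measure.real]
    rw [← h2]
    exact setIntegral_le_integral g.integrable (ae_of_all _ g0)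

/-- An `s`-uniform measure. -/
structure Unif {n : ℕ} (ν : Measure (Heis n)) (s : ℝ) : Prop where
  ball : ∀ x ∈ suppH ν, ∀ r > 0, ν (ballH x r) = ENNReal.ofReal (r ^ s)
  zero : eH ∈ suppH ν

lemma limit_unif {n : ℕ} {s : ℝ} (hs : 0 < s) (μ : ℕ → Measure (Heis n))
    [∀ j, IsFiniteMeasureOnCompacts (μ j)]
    (E : ℕ → Set (Heis n)) (hE0 : ∀ j, eH ∈ E j)
    (h1 : ∀ R > 0, ∀ ε > 0, ∀ᶠ j in atTop, ∀ x ∈ E j, KNorm x ≤ R → ∀ ρ, ε ≤ ρ → ρ ≤ R →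
      ENNReal.ofReal (ρ ^ s - ε) ≤ μ j (ballH x ρ) ∧ μ j (ballH x ρ) ≤ ENNReal.ofReal (ρ ^ s + ε))
    (h2 : ∀ R > 0, ∀ ε > 0, ∀ᶠ j in atTop, μ j (ballH eH R \ E j) ≤ ENNReal.ofReal ε) :
    ∃ ν : Measure (Heis n), Unif ν s ∧ ∀ y ∈ suppH ν, ∀ ε > 0, ∃ᶠ j in atTop,
      ∃ z ∈ E j, dH y z ≤ ε := by
  obtain ⟨U, hU⟩ : ∃ U : Ultrafilter ℕ, (U : Filter ℕ) ≤ atTop := Ultrafilter.exists_le atTop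
  have hb : ∀ R : ℝ, ∃ C : ℝ, ∀ᶠ j in U, μ j (ballH eH R) ≤ ENNReal.ofReal C := by
    intro R
    refine ⟨(max R 1) ^ s + 1, ?_⟩
    filter_upwards [hU (h1 (max R 1) (by positivity) 1 one_pos)] with j hj
    refine (measure_mono (ballH_subset (t := max R 1) ?_)).trans
      (hj eH (hE0 j) (by rw [KNorm_eH]; positivity) (max R 1) (le_max_right _ _) le_rfl).2
    rw [dH_self, zero_add]; exact le_max_left _ _
  obtain ⟨ν, hup, hlo⟩ := vague_limit μ U hb
  -- key estimate
  have key : ∀ x : Heis n, (∀ ε > 0, ∀ᶠ j in U, ∃ z ∈ E j, dH x z ≤ ε) → ∀ r > 0,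
      ν (ballH x r) = ENNReal.ofReal (r ^ s) := by
    intro x hx r hr
    have upper : ∀ ε > 0, ε < r → ν (ballH x r) ≤ ENNReal.ofReal ((r + 2 * ε) ^ s + ε) := by
      intro ε hε hεr
      refine hup x r (r + ε) _ (by linarith) (by positivity) ?_
      have hR : 0 < KNorm x + r + 2 * ε := by have := KNorm_nonneg x; positivity
      filter_upwards [hx ε hε, hU (h1 (KNorm x + r + 2 * ε) hR ε hε)] with j ⟨z, hz, hxz⟩ hj
      refine (measure_mono (ballH_subset (t := r + 2 * ε) ?_)).trans
        (hj z hz ?_ (r + 2 * ε) (by linarith) (by linarith [KNorm_nonneg x])).2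
      · rw [dH_comm]; linarith
      · rw [← dH_eH]
        refine (dH_triangle eH x z).trans ?_
        rw [dH_eH]; linarith
    have lower : ∀ ε > 0, 4 * ε < r → ENNReal.ofReal ((r - 2 * ε) ^ s - ε) ≤ ν (ballH x r) := by
      intro ε hε hεr
      refine hlo x (r - ε) r _ (by linarith) ?_
      have hR : 0 < KNorm x + r + 2 * ε := by have := KNorm_nonneg x; positivity
      filter_upwards [hx ε hε, hU (h1 (KNorm x + r + 2 * ε) hR ε hε)] with j ⟨z, hz, hxz⟩ hj
      refine le_trans (hj z hz ?_ (r - 2 * ε) (by linarith) (by linarith [KNorm_nonneg x])).1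
        (measure_mono (ballH_subset (t := r - ε) ?_))
      · rw [← dH_eH]
        refine (dH_triangle eH x z).trans ?_
        rw [dH_eH]; linarith
      · linarith
    apply le_antisymm
    · have ht : Tendsto (fun ε : ℝ => ENNReal.ofReal ((r + 2 * ε) ^ s + ε)) (𝓝[>] 0)
          (𝓝 (ENNReal.ofReal ((r + 2 * 0) ^ s + 0))) := by
        apply ENNReal.tendsto_ofReal
        apply tendsto_nhdsWithin_of_tendsto_nhds
        have : Continuous fun ε : ℝ => (r + 2 * ε) ^ s + ε :=
          ((by fun_prop : Continuous fun ε : ℝ => r + 2 * ε).rpow_const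
            fun x => Or.inr hs.le).add continuous_id
        exact this.tendsto 0
      simp only [mul_zero, add_zero] at ht
      refine ge_of_tendsto ht ?_
      filter_upwards [Ioo_mem_nhdsGT hr] with ε hε
      exact upper ε hε.1 hε.2
    · have ht : Tendsto (fun ε : ℝ => ENNReal.ofReal ((r - 2 * ε) ^ s - ε)) (𝓝[>] 0)
          (𝓝 (ENNReal.ofReal ((r - 2 * 0) ^ s - 0))) := by
        apply ENNReal.tendsto_ofReal
        apply tendsto_nhdsWithin_of_tendsto_nhds
        have : Continuous fun ε : ℝ => (r - 2 * ε) ^ s - ε :=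
          ((by fun_prop : Continuous fun ε : ℝ => r - 2 * ε).rpow_const
            fun x => Or.inr hs.le).sub continuous_id
        exact this.tendsto 0
      simp only [mul_zero, sub_zero] at ht
      refine le_of_tendsto ht ?_
      filter_upwards [Ioo_mem_nhdsGT (show (0 : ℝ) < r / 4 by positivity)] with ε hε
      exact lower ε hε.1 (by linarith [hε.2])
  have supp : ∀ y ∈ suppH ν, ∀ ε > 0, ∀ᶠ j in U, ∃ z ∈ E j, dH y z ≤ ε := by
    intro y hy ε hε
    by_contra hcon
    rw [← Ultrafilter.eventually_not] at hcon
    have hz : ν (ballH y (ε / 2)) = 0 := by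
      rw [← nonpos_iff_eq_zero]
      refine _root_.le_of_forall_pos_le_add (fun η hη => ?_)
      rw [zero_add]
      rcases eq_or_ne η ⊤ with rfl | hηt
      · exact le_top
      rw [← ENNReal.ofReal_toReal hηt]
      have hη' : 0 < η.toReal := ENNReal.toReal_pos hη.ne' hηt
      refine hup y (ε / 2) ε _ (by linarith) hη'.le ?_
      have hR : 0 < KNorm y + ε := by have := KNorm_nonneg y; positivity
      filter_upwards [hcon, hU (h2 _ hR _ hη')] with j hj1 hj2
      have hsub : ballH y ε ⊆ ballH eH (KNorm y + ε) \ E j := fun z hz =>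
        ⟨ballH_subset (by rw [dH_eH]) hz, fun hzE => hj1 ⟨z, hzE, hz⟩⟩
      exact (measure_mono hsub).trans hj2
    exact (hy (ε / 2) (by positivity)).ne' hz
  refine ⟨ν, ⟨fun x hx => key x (supp x hx), fun r hr => ?_⟩, fun y hy ε hε => ?_⟩
  · rw [key eH (fun ε hε => Eventually.of_forall fun j => ⟨eH, hE0 j, by rw [dH_self]; exact hε.le⟩)
      r hr]
    simp only [ENNReal.ofReal_pos]
    positivity
  · exact (supp y hy ε hε).frequently.filter_mono hU

/-- Blow-up lemma. -/
lemma blowup {n : ℕ} {s : ℝ} (hs : 0 < s) (μ : Measure (Heis n)) [IsFiniteMeasureOnCompacts μ]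
    (a : Heis n) (r : ℕ → ℝ) (hr : ∀ j, 0 < r j) (c : ℕ → ℝ≥0)
    (E : ℕ → Set (Heis n)) (hEm : ∀ j, MeasurableSet (E j)) (hE0 : ∀ j, a ∈ E j)
    (h1 : ∀ R > 0, ∀ ε > 0, ∀ᶠ j in atTop, ∀ x ∈ E j, dH a x ≤ R * r j → ∀ ρ, ε ≤ ρ → ρ ≤ R →
      ENNReal.ofReal (ρ ^ s - ε) ≤ c j * μ (ballH x (ρ * r j)) ∧
        c j * μ (ballH x (ρ * r j)) ≤ ENNReal.ofReal (ρ ^ s + ε))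
    (h2 : ∀ R > 0, ∀ ε > 0, ∀ᶠ j in atTop,
      c j * μ (ballH a (R * r j) \ E j) ≤ ENNReal.ofReal ε) :
    ∃ ν : Measure (Heis n), Unif ν s ∧ ∀ y ∈ suppH ν, ∀ ε > 0, ∃ᶠ j in atTop,
      ∃ k, hmul a (dil (r j) k) ∈ E j ∧ dH y k ≤ ε := by
  let T : ℕ → Heis n → Heis n := fun j z => dil (r j)⁻¹ (hmul (hinv a) z)
  have hTc : ∀ j, Continuous (T j) := fun j => (continuous_dil _).comp (continuous_hmul_left _)
  let S : ℕ → Heis n → Heis n := fun j z => hmul a (dil (r j) z)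
  have hSc : ∀ j, Continuous (S j) := fun j => (continuous_hmul_left _).comp (continuous_dil _)
  have hST : ∀ j z, S j (T j z) = z := by
    intro j z
    simp only [S, T]
    rw [dil_dil, mul_inv_cancel₀ (hr j).ne', dil_one, hmul_hinv_cancel]
  have hdS : ∀ j x, dH a (S j x) = r j * KNorm x := by
    intro j x
    simp only [S]
    rw [dH_hmul_right, KNorm_dil (hr j).le]
  have hpre : ∀ j x ρ, T j ⁻¹' ballH x ρ = ballH (S j x) (ρ * r j) := fun j x ρ =>
    ballH_eq_dil a x (hr j) ρ
  let μ' : ℕ → Measure (Heis n) := fun j => c j • μ.map (T j)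
  have hμb : ∀ j A, MeasurableSet A → μ' j A = c j * μ (T j ⁻¹' A) := by
    intro j A hA
    simp only [μ', Measure.smul_apply, Measure.map_apply (hTc j).measurable hA]
    rfl
  have hSe : ∀ j, S j eH = a := by
    intro j
    simp [S, dil, eH, hmul, symp_zero_right]
  have inst : ∀ j, IsFiniteMeasureOnCompacts (μ' j) := by
    intro j
    refine ⟨fun K hK => ?_⟩
    rw [hμb j K hK.measurableSet]
    refine ENNReal.mul_lt_top ENNReal.coe_lt_top ?_
    refine lt_of_le_of_lt (measure_mono fun z hz => ?_) (hK.image (hSc j)).measure_lt_top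
    exact ⟨T j z, hz, hST j z⟩
  obtain ⟨ν, hν, h3⟩ := limit_unif hs μ' (fun j => S j ⁻¹' E j) (fun j => by
      simp only [mem_preimage, hSe]; exact hE0 j) (by
      intro R hR ε hε
      filter_upwards [h1 R hR ε hε] with j hj x hx hxR ρ h1 h2
      rw [hμb j _ (measurableSet_ballH _ _), hpre]
      refine hj _ hx ?_ ρ h1 h2
      rw [hdS, mul_comm]
      exact mul_le_mul_of_nonneg_right hxR (hr j).le) (by
      intro R hR ε hε
      filter_upwards [h2 R hR ε hε] with j hj
      rw [hμb j _ ((measurableSet_ballH _ _).diff ((hSc j).measurable (hEm j))), preimage_sdiff,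
        hpre, hSe, ← preimage_comp]
      have : S j ∘ T j = id := funext (hST j)
      rw [this, preimage_id]
      exact hj)
  refine ⟨ν, hν, fun y hy ε hε => (h3 y hy ε hε).mono fun j ⟨z, hz, hyz⟩ => ⟨z, hz, hyz⟩⟩

lemma Unif.finite {n : ℕ} {s : ℝ} {ν : Measure (Heis n)} (h : Unif ν s) :
    IsFiniteMeasureOnCompacts ν := by
  refine ⟨fun K hK => ?_⟩
  obtain ⟨R, hR⟩ := (hK.image (continuous_KNorm (n := n))).isBounded.subset_closedBall 0
  have : K ⊆ ballH eH (max R 1) := fun y hy => by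
    have := hR (mem_image_of_mem KNorm hy)
    rw [mem_closedBall_zero_iff, Real.norm_eq_abs] at this
    rw [mem_ballH, dH_eH]
    exact ((le_abs_self _).trans this).trans (le_max_left _ _)
  refine lt_of_le_of_lt (measure_mono this) ?_
  rw [h.ball eH h.zero _ (by positivity)]
  exact ENNReal.ofReal_lt_top

lemma isClosed_suppH {n : ℕ} (ν : Measure (Heis n)) : IsClosed (suppH ν) := by
  rw [← isOpen_compl_iff, isOpen_iff_mem_nhds]
  intro x hx
  obtain ⟨r, hr, h0⟩ : ∃ r > 0, ν (ballH x r) = 0 := by simpa [suppH] using hx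
  refine mem_of_superset (ballH_mem_nhds x (half_pos hr)) fun y hy hy2 => ?_
  have : ν (ballH y (r / 2)) ≤ ν (ballH x r) :=
    measure_mono (ballH_subset (by have : dH x y ≤ r / 2 := hy; linarith))
  have h3 := hy2 (r / 2) (by positivity)
  rw [h0] at this
  exact absurd this (not_le.2 h3)

/-- Tangents of uniform measures. -/
lemma tangent {n : ℕ} {s : ℝ} (hs : 0 < s) {ν : Measure (Heis n)} (h : Unif ν s)
    {x : Heis n} (hx : x ∈ suppH ν) :
    ∃ ν' : Measure (Heis n), Unif ν' s ∧ ∀ y ∈ suppH ν', ∃ (r : ℕ → ℝ) (k : ℕ → Heis n),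
      (∀ m, 0 < r m) ∧ Tendsto r atTop (𝓝 0) ∧ Tendsto k atTop (𝓝 y) ∧
      ∀ m, hmul x (dil (r m) (k m)) ∈ suppH ν := by
  have := h.finite
  let r : ℕ → ℝ := fun j => 1 / ((j : ℝ) + 1)
  have hr : ∀ j, 0 < r j := fun j => by positivity
  have hr0 : Tendsto r atTop (𝓝 0) := tendsto_one_div_add_atTop_nhds_zero_nat
  obtain ⟨ν', h', h3⟩ := blowup hs ν x r hr (fun j => Real.toNNReal ((r j) ^ s)⁻¹)
    (fun _ => suppH ν) (fun _ => (isClosed_suppH ν).measurableSet) (fun _ => hx) (by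
      intro R hR ε hε
      refine Eventually.of_forall fun j z hz _ ρ hρ1 _ => ?_
      have hρ : 0 < ρ := lt_of_lt_of_le hε hρ1
      have : ((Real.toNNReal ((r j) ^ s)⁻¹ : ℝ≥0) : ℝ≥0∞) * ν (ballH z (ρ * r j)) =
          ENNReal.ofReal (ρ ^ s) := by
        rw [h.ball z hz _ (mul_pos hρ (hr j))]
        change ENNReal.ofReal _ * _ = _
        have := hr j
        rw [← ENNReal.ofReal_mul (by positivity), Real.mul_rpow hρ.le (hr j).le]
        congr 1
        have : r j ^ s ≠ 0 := by positivity
        field_simp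
      rw [this]
      exact ⟨ENNReal.ofReal_le_ofReal (by linarith), ENNReal.ofReal_le_ofReal (by linarith)⟩) (by
      intro R hR ε hε
      refine Eventually.of_forall fun j => ?_
      have : ν (ballH x (R * r j) \ suppH ν) = 0 :=
        measure_mono_null (fun z hz => hz.2) (measure_compl_suppH ν)
      rw [this, mul_zero]
      exact zero_le)
  refine ⟨ν', h', fun y hy => ?_⟩
  have h4 : ∀ m : ℕ, ∃ j : ℕ, m ≤ j ∧ ∃ k, hmul x (dil (r j) k) ∈ suppH ν ∧
      dH y k ≤ 1 / ((m : ℝ) + 1) := by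
    intro m
    obtain ⟨j, ⟨k, hk⟩, hj⟩ := ((h3 y hy (1 / ((m : ℝ) + 1)) (by positivity)).and_eventually
      (eventually_ge_atTop m)).exists
    exact ⟨j, hj, k, hk⟩
  choose j hj k hk1 hk2 using h4
  refine ⟨fun m => r (j m), k, fun m => hr _, hr0.comp (tendsto_atTop_mono hj tendsto_id), ?_, hk1⟩
  refine tendsto_of_dH (squeeze_zero (fun _ => dH_nonneg _ _) hk2 ?_)
  exact tendsto_one_div_add_atTop_nhds_zero_nat

/-- The Korányi metric as a pseudometric space structure. -/
@[reducible] def metH (n : ℕ) : PseudoMetricSpace (Heis n) :=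
  PseudoMetricSpace.ofDistTopology dH dH_self dH_comm dH_triangle (fun s => by
    rw [isOpen_iff_mem_nhds]
    refine forall₂_congr fun x _ => ⟨fun h => ?_, fun ⟨ε, hε, h⟩ => ?_⟩
    · obtain ⟨ε, hε, h2⟩ := exists_ballH_subset x h
      exact ⟨ε, hε, fun y hy => h2 hy.le⟩
    · exact mem_of_superset (ballH_mem_nhds x (half_pos hε)) fun y hy =>
        h y (lt_of_le_of_lt hy (half_lt_self hε)))

lemma vitali_H {n : ℕ} (μ : Measure (Heis n)) [IsLocallyFiniteMeasure μ] (s : Set (Heis n))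
    (t : Set (Heis n × ℝ)) (C : ℝ≥0) (hpos : ∀ a ∈ t, 0 < a.2)
    (μB : ∀ a ∈ t, μ (ballH a.1 (3 * a.2)) ≤ C * μ (ballH a.1 a.2))
    (hf : ∀ x ∈ s, ∀ ε > (0 : ℝ), ∃ a ∈ t, a.2 ≤ ε ∧ a.1 = x) :
    ∃ u ⊆ t, u.Countable ∧ u.PairwiseDisjoint (fun a => ballH a.1 a.2) ∧
      μ (s \ ⋃ a ∈ u, ballH a.1 a.2) = 0 := by
  have hcb : ∀ x r, @Metric.closedBall (Heis n) (metH n) x r = ballH x r := by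
    intro x r
    ext y
    change dH y x ≤ r ↔ dH x y ≤ r
    rw [dH_comm]
  refine @Vitali.exists_disjoint_covering_ae (Heis n) (Heis n × ℝ) (metH n) _ _ _ μ _ s t C
    (fun a => a.2) (fun a => a.1) (fun a => ballH a.1 a.2) ?_ ?_ ?_ ?_ hf
  · intro a _
    rw [hcb]
  · intro a ha
    rw [hcb]
    exact μB a ha
  · intro a ha
    exact ⟨a.1, mem_interior_iff_mem_nhds.2 (ballH_mem_nhds a.1 (hpos a ha))⟩
  · intro a _
    exact isClosed_ballH _ _

lemma density_H {n : ℕ} {s : ℝ} (μ : Measure (Heis n)) [μ.Regular] {E : Set (Heis n)}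
    (hE : IsClosed E) {c₁ c₂ δ : ℝ} (hc₁ : 0 < c₁) (hc₂ : 0 < c₂) (hδ : 0 < δ)
    (hlow : ∀ x ∈ E, ∀ r, 0 < r → r < δ → ENNReal.ofReal (c₁ * r ^ s) ≤ μ (ballH x r))
    (hup : ∀ x ∈ E, ∀ r, 0 < r → r < δ → μ (ballH x r) ≤ ENNReal.ofReal (c₂ * r ^ s)) :
    ∀ᵐ x ∂μ, x ∈ E → ∀ η > 0, ∀ᶠ r in 𝓝[>] (0 : ℝ),
      μ (ballH x r \ E) ≤ ENNReal.ofReal (η * r ^ s) := by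
  have main : ∀ η > 0, ∀ R : ℝ, μ {x | x ∈ E ∧ KNorm x ≤ R ∧ ∃ᶠ r in 𝓝[>] (0 : ℝ),
      ENNReal.ofReal (η * r ^ s) < μ (ballH x r \ E)} = 0 := by
    intro η hη R
    set Z : Set (Heis n) := {x | x ∈ E ∧ KNorm x ≤ R ∧ ∃ᶠ r in 𝓝[>] (0 : ℝ),
      ENNReal.ofReal (η * r ^ s) < μ (ballH x r \ E)} with hZ
    set E' := E ∩ ballH eH R with hE'
    have hE'c : IsCompact E' := (isCompact_ballH eH R).inter_left hE
    have hZE' : Z ⊆ E' := fun x hx => ⟨hx.1, by rw [mem_ballH, dH_eH]; exact hx.2.1⟩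
    have key : ∀ ε : ℝ≥0, 0 < ε → μ Z ≤ ENNReal.ofReal (c₂ / η) * ε := by
      intro ε hε
      obtain ⟨U, hEU, hU, hμU⟩ := Set.exists_isOpen_le_add E' μ (ε := ε) (by exact_mod_cast hε.ne')
      have hdiff : μ (U \ E') ≤ ε := by
        rw [measure_sdiff hEU hE'c.measurableSet.nullMeasurableSet hE'c.measure_lt_top.ne]
        exact tsub_le_iff_left.2 hμU
      let t : Set (Heis n × ℝ) := {a | a.1 ∈ Z ∧ 0 < a.2 ∧ a.2 < δ / 3 ∧ ballH a.1 a.2 ⊆ U ∧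
        ENNReal.ofReal (η * a.2 ^ s) < μ (ballH a.1 a.2 \ E)}
      obtain ⟨u, hut, huc, hud, hu0⟩ := vitali_H μ Z t (Real.toNNReal (c₂ * 3 ^ s / c₁))
        (fun a ha => ha.2.1) (by
          rintro ⟨x, r⟩ ⟨hxZ, hr, hrδ, -, -⟩
          refine (hup x hxZ.1 (3 * r) (by linarith) (by simp only at hrδ; linarith)).trans ?_
          refine le_trans ?_ (mul_le_mul_right (hlow x hxZ.1 r hr (by simp only at hrδ; linarith)) _)
          change _ ≤ ENNReal.ofReal _ * _
          simp only at hr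
          rw [← ENNReal.ofReal_mul (by positivity), Real.mul_rpow (by norm_num) hr.le]
          apply ENNReal.ofReal_le_ofReal
          apply le_of_eq
          field_simp) (by
          intro x hx ε' hε'
          obtain ⟨ρ, hρ, hρU⟩ := exists_ballH_subset x (hU.mem_nhds (hEU (hZE' hx)))
          obtain ⟨r, hr, hr2⟩ := (hx.2.2.and_eventually (Ioo_mem_nhdsGT
            (show (0 : ℝ) < min (min ρ ε') (δ / 3) by positivity))).exists
          have h1 := lt_min_iff.1 hr2.2
          have h2 := lt_min_iff.1 h1.1
          refine ⟨(x, r), ⟨hx, hr2.1, h1.2, ?_, hr⟩, h2.2.le, rfl⟩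
          refine (ballH_subset ?_).trans hρU
          rw [dH_self, zero_add]
          exact h2.1.le)
      have hZs : μ Z ≤ μ (⋃ a ∈ u, ballH a.1 a.2) := by
        refine (measure_le_inter_add_sdiff μ Z (⋃ a ∈ u, ballH a.1 a.2)).trans ?_
        rw [hu0, add_zero]
        exact measure_mono inter_subset_right
      have hd : μ (⋃ a ∈ u, (ballH a.1 a.2 \ E)) ≤ ε := by
        refine (measure_mono ?_).trans hdiff
        intro z hz
        simp only [mem_iUnion] at hz
        obtain ⟨a, ha, hz⟩ := hz
        exact ⟨(hut ha).2.2.2.1 hz.1, fun h => hz.2 h.1⟩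
      rw [measure_biUnion huc (fun a ha b hb hab => (hud ha hb hab).mono sdiff_subset sdiff_subset)
        (fun a _ => (measurableSet_ballH _ _).diff hE.measurableSet)] at hd
      refine hZs.trans ((measure_biUnion_le μ huc _).trans ?_)
      refine le_trans ?_ (mul_le_mul_right hd _)
      rw [← ENNReal.tsum_mul_left]
      refine ENNReal.tsum_le_tsum fun a => ?_
      obtain ⟨h1, h2, h3, -, h5⟩ := hut a.2
      refine (hup _ h1.1 _ h2 (by linarith)).trans ?_
      refine le_trans ?_ (mul_le_mul_right h5.le _)
      rw [← ENNReal.ofReal_mul (by positivity)]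
      apply ENNReal.ofReal_le_ofReal
      apply le_of_eq
      field_simp
    have hfin : μ Z ≠ ⊤ := ((measure_mono hZE').trans_lt hE'c.measure_lt_top).ne
    by_contra h0
    have hp : 0 < (μ Z).toReal := ENNReal.toReal_pos h0 hfin
    have := key (Real.toNNReal ((μ Z).toReal / (2 * (c₂ / η)))) (by
      rw [Real.toNNReal_pos]; positivity)
    change _ ≤ _ * ENNReal.ofReal _ at this
    rw [← ENNReal.ofReal_mul (by positivity), ← ENNReal.ofReal_toReal hfin,
      ENNReal.ofReal_le_ofReal_iff (by positivity), ENNReal.toReal_ofReal hp.le] at this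
    have e : c₂ / η * ((μ Z).toReal / (2 * (c₂ / η))) = (μ Z).toReal / 2 := by field_simp
    rw [e] at this
    linarith
  have h2 : ∀ᵐ x ∂μ, ∀ k R : ℕ, ¬ (x ∈ E ∧ KNorm x ≤ R ∧ ∃ᶠ r in 𝓝[>] (0 : ℝ),
      ENNReal.ofReal (1 / ((k : ℝ) + 1) * r ^ s) < μ (ballH x r \ E)) := by
    rw [ae_all_iff]; intro k
    rw [ae_all_iff]; intro R
    have := main (1 / ((k : ℝ) + 1)) (by positivity) R
    rw [ae_iff]
    simpa only [not_not] using this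
  filter_upwards [h2] with x hx hxE η hη
  obtain ⟨k, hk⟩ := exists_nat_one_div_lt hη
  obtain ⟨R, hR⟩ := exists_nat_ge (KNorm x)
  have h3 := hx k R
  simp only [hxE, hR, true_and, not_frequently, not_lt] at h3
  filter_upwards [h3, self_mem_nhdsWithin] with r hr hr0
  refine hr.trans (ENNReal.ofReal_le_ofReal ?_)
  have : 0 < r := hr0
  gcongr

/-- Points where the ball growth is controlled at all scales below `δ`. -/
def Gset {n : ℕ} (μ : Measure (Heis n)) (s c₁ c₂ δ : ℝ) : Set (Heis n) :=
  {x | ∀ r, 0 < r → r < δ → ENNReal.ofReal (c₁ * r ^ s) ≤ μ (ballH x r) ∧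
    μ (ballH x r) ≤ ENNReal.ofReal (c₂ * r ^ s)}

lemma isClosed_Gset {n : ℕ} (μ : Measure (Heis n)) {s : ℝ} (hs : 0 < s) (c₁ c₂ δ : ℝ) :
    IsClosed (Gset μ s c₁ c₂ δ) := by
  refine isClosed_of_closure_subset fun x hx r hr hrδ => ?_
  have hap : ∀ ε > 0, ∃ z ∈ Gset μ s c₁ c₂ δ, dH x z ≤ ε := by
    intro ε hε
    obtain ⟨z, hz1, hz2⟩ := mem_closure_iff_nhds.1 hx _ (ballH_mem_nhds x hε)
    exact ⟨z, hz2, hz1⟩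
  constructor
  · have ht : Tendsto (fun ε : ℝ => ENNReal.ofReal (c₁ * (r - ε) ^ s)) (𝓝[>] 0)
        (𝓝 (ENNReal.ofReal (c₁ * (r - 0) ^ s))) := by
      apply ENNReal.tendsto_ofReal
      apply tendsto_nhdsWithin_of_tendsto_nhds
      have : Continuous fun ε : ℝ => c₁ * (r - ε) ^ s :=
        continuous_const.mul ((by fun_prop : Continuous fun ε : ℝ => r - ε).rpow_const
          fun x => Or.inr hs.le)
      exact this.tendsto 0
    rw [sub_zero] at ht
    refine le_of_tendsto ht ?_
    filter_upwards [Ioo_mem_nhdsGT hr] with ε hε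
    obtain ⟨z, hz, hxz⟩ := hap ε hε.1
    exact (hz (r - ε) (by linarith [hε.2]) (by linarith [hε.1])).1.trans
      (measure_mono (ballH_subset (by linarith)))
  · have ht : Tendsto (fun ε : ℝ => ENNReal.ofReal (c₂ * (r + ε) ^ s)) (𝓝[>] 0)
        (𝓝 (ENNReal.ofReal (c₂ * (r + 0) ^ s))) := by
      apply ENNReal.tendsto_ofReal
      apply tendsto_nhdsWithin_of_tendsto_nhds
      have : Continuous fun ε : ℝ => c₂ * (r + ε) ^ s :=
        continuous_const.mul ((by fun_prop : Continuous fun ε : ℝ => r + ε).rpow_const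
          fun x => Or.inr hs.le)
      exact this.tendsto 0
    rw [add_zero] at ht
    refine ge_of_tendsto ht ?_
    filter_upwards [Ioo_mem_nhdsGT (show (0 : ℝ) < δ - r by linarith)] with ε hε
    obtain ⟨z, hz, hxz⟩ := hap ε hε.1
    exact (measure_mono (ballH_subset (by rw [dH_comm]; linarith))).trans
      (hz (r + ε) (by linarith [hε.1]) (by linarith [hε.2])).2

lemma mem_Gset_of_density {n : ℕ} {μ : Measure (Heis n)} {s : ℝ} {x : Heis n}
    {d : ℝ≥0∞} (hd0 : 0 < d) (hdt : d < ⊤) (h : HasDensity μ s x d) {ε : ℝ} (hε : 0 < ε)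
    (hε1 : ε < 1) :
    ∃ (q : ℚ) (k : ℕ), 0 < q ∧ x ∈ Gset μ s ((1 - ε) * q) ((1 + ε) * q) (1 / ((k : ℝ) + 1)) := by
  have hD : 0 < d.toReal := ENNReal.toReal_pos hd0.ne' hdt.ne
  have h1 : 0 < 1 - ε := by linarith
  obtain ⟨q, hq1, hq2⟩ := exists_rat_btwn (show d.toReal / (1 + ε) < d.toReal / (1 - ε) by
    apply div_lt_div_of_pos_left hD h1; linarith)
  have hq : (0 : ℝ) < q := lt_trans (by positivity) hq1
  rw [div_lt_iff₀ (by linarith)] at hq1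
  rw [lt_div_iff₀ h1] at hq2
  have ha : ENNReal.ofReal ((1 - ε) * q) < d := by
    rw [ENNReal.ofReal_lt_iff_lt_toReal (by positivity) hdt.ne]; linarith
  have hb : d < ENNReal.ofReal ((1 + ε) * q) := by
    rw [ENNReal.lt_ofReal_iff_toReal_lt hdt.ne]; linarith
  have hev := h.eventually (Ioo_mem_nhds ha hb)
  obtain ⟨δ, hδ, hδ2⟩ := mem_nhdsGT_iff_exists_Ioo_subset.1 hev
  obtain ⟨k, hk⟩ := exists_nat_one_div_lt (show (0 : ℝ) < δ from hδ)
  refine ⟨q, k, by exact_mod_cast hq, fun r hr hrk => ?_⟩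
  have h3 : μ (ballH x r) / ENNReal.ofReal (r ^ s) ∈ Ioo _ _ := hδ2 ⟨hr, hrk.trans hk⟩
  have hrs : 0 < r ^ s := by positivity
  rw [ENNReal.ofReal_mul (by positivity), ENNReal.ofReal_mul (p := (1 + ε) * q) (by positivity)]
  constructor
  · have := h3.1.le
    rwa [ENNReal.le_div_iff_mul_le (Or.inl (by simpa using hrs)) (Or.inl ENNReal.ofReal_ne_top)] at this
  · have := h3.2.le
    rwa [ENNReal.div_le_iff_le_mul (Or.inl (by simpa using hrs)) (Or.inl ENNReal.ofReal_ne_top)] at this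

lemma exists_unif {n : ℕ} {s : ℝ} (hs : 0 < s) (μ : Measure (Heis n)) [μ.Regular]
    (h : 0 < μ {x : Heis n | ∃ d : ℝ≥0∞, 0 < d ∧ d < ⊤ ∧ HasDensity μ s x d}) :
    ∃ ν : Measure (Heis n), Unif ν s := by
  let e : ℕ → ℝ := fun m => 1 / ((m : ℝ) + 2)
  have he0 : ∀ m, 0 < e m := fun m => by positivity
  have he1 : ∀ m, e m < 1 := fun m => by
    simp only [e]; rw [div_lt_one (by positivity)]
    have : (0 : ℝ) ≤ m := by positivity
    linarith
  have helim : Tendsto e atTop (𝓝 0) := by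
    refine squeeze_zero (fun m => (he0 m).le) (fun m => ?_) tendsto_one_div_add_atTop_nhds_zero_nat
    apply one_div_le_one_div_of_le <;> first | positivity | linarith
  let G : ℕ → ℚ → ℕ → Set (Heis n) := fun m q k =>
    Gset μ s ((1 - e m) * q) ((1 + e m) * q) (1 / ((k : ℝ) + 1))
  have hae : ∀ᵐ x ∂μ, ∀ (m : ℕ) (q : ℚ) (k : ℕ), 0 < q → x ∈ G m q k → ∀ η > 0,
      ∀ᶠ r in 𝓝[>] (0 : ℝ), μ (ballH x r \ G m q k) ≤ ENNReal.ofReal (η * r ^ s) := by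
    simp only [ae_all_iff]
    intro m q k hq
    have hq' : (0 : ℝ) < q := by exact_mod_cast hq
    have h1 : 0 < 1 - e m := by linarith [he1 m]
    have h2 : 0 < 1 + e m := by linarith [he0 m]
    exact density_H (s := s) μ (isClosed_Gset μ hs _ _ _) (mul_pos h1 hq') (mul_pos h2 hq')
      (show (0 : ℝ) < 1 / ((k : ℝ) + 1) by positivity)
      (fun x hx r h1 h2 => (hx r h1 h2).1) (fun x hx r h1 h2 => (hx r h1 h2).2)
  obtain ⟨a, ⟨d, hd0, hdt, hd⟩, ha⟩ : ∃ a, (∃ d : ℝ≥0∞, 0 < d ∧ d < ⊤ ∧ HasDensity μ s a d) ∧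
      ∀ (m : ℕ) (q : ℚ) (k : ℕ), 0 < q → a ∈ G m q k → ∀ η > 0,
      ∀ᶠ r in 𝓝[>] (0 : ℝ), μ (ballH a r \ G m q k) ≤ ENNReal.ofReal (η * r ^ s) := by
    by_contra hcon
    push Not at hcon
    refine h.ne' (measure_mono_null ?_ (ae_iff.1 hae))
    intro x hx hx2
    obtain ⟨m, q, k, h1, h2, η, h3, h4⟩ := hcon x hx
    exact h4 ((hx2 m q k h1 h2 η h3).mono fun _ h => not_lt.2 h)
  choose q k hq hmem using fun m => mem_Gset_of_density hd0 hdt hd (he0 m) (he1 m)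
  have hq' : ∀ m, (0 : ℝ) < q m := fun m => by exact_mod_cast hq m
  have hex : ∀ m : ℕ, ∃ t : ℝ, 0 < t ∧ t < 1 / ((k m : ℝ) + 1) ∧
      μ (ballH a t \ G m (q m) (k m)) ≤
        ENNReal.ofReal ((q m * e m / ((m : ℝ) + 1) ^ s) * t ^ s) := by
    intro m
    have h1 := ha m (q m) (k m) (hq m) (hmem m) (q m * e m / ((m : ℝ) + 1) ^ s) (by
      have := hq' m; have := he0 m; positivity)
    obtain ⟨t, ht1, ht2⟩ := (h1.and (Ioo_mem_nhdsGT
      (show (0 : ℝ) < 1 / ((k m : ℝ) + 1) by positivity))).exists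
    exact ⟨t, ht2.1, ht2.2, ht1⟩
  choose t ht0 htk ht using hex
  let r : ℕ → ℝ := fun m => t m / ((m : ℝ) + 1)
  have hr : ∀ m, 0 < r m := fun m => div_pos (ht0 m) (by positivity)
  have hrt : ∀ m : ℕ, ((m : ℝ) + 1) * r m = t m := fun m => by
    simp only [r]; field_simp
  have hbig : ∀ R : ℝ, ∀ᶠ m : ℕ in atTop, R ≤ (m : ℝ) + 1 := by
    intro R
    obtain ⟨N, hN⟩ := exists_nat_ge R
    filter_upwards [eventually_ge_atTop N] with m hm
    have : (N : ℝ) ≤ m := by exact_mod_cast hm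
    linarith
  obtain ⟨ν, hν, -⟩ := blowup hs μ a r hr (fun m => Real.toNNReal (1 / (q m * r m ^ s)))
    (fun m => G m (q m) (k m)) (fun m => (isClosed_Gset μ hs _ _ _).measurableSet) hmem (by
      intro R hR ε hε
      have hsm : ∀ᶠ m in atTop, R ^ s * e m < ε := by
        have : Tendsto (fun m => R ^ s * e m) atTop (𝓝 (R ^ s * 0)) := helim.const_mul _
        rw [mul_zero] at this
        exact this.eventually (gt_mem_nhds hε)
      filter_upwards [hsm, hbig R] with m hm1 hm2 x hx _ ρ hρ1 hρ2
      have hρ : 0 < ρ := lt_of_lt_of_le hε hρ1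
      have hrm := hr m
      have hqm := hq' m
      have hem := he0 m
      have hlt : ρ * r m < 1 / ((k m : ℝ) + 1) := by
        refine lt_of_le_of_lt ?_ (htk m)
        rw [← hrt m]
        exact mul_le_mul_of_nonneg_right (hρ2.trans hm2) hrm.le
      obtain ⟨h1, h2⟩ := hx (ρ * r m) (by positivity) hlt
      have hρR : ρ ^ s * e m ≤ R ^ s * e m := by gcongr
      have hrs : 0 < r m ^ s := by positivity
      constructor
      · refine le_trans ?_ (mul_le_mul_right h1 _)
        change _ ≤ ENNReal.ofReal _ * _
        rw [← ENNReal.ofReal_mul (by positivity), Real.mul_rpow hρ.le hrm.le]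
        apply ENNReal.ofReal_le_ofReal
        have : 1 / (q m * r m ^ s) * ((1 - e m) * q m * (ρ ^ s * r m ^ s)) =
          ρ ^ s - ρ ^ s * e m := by field_simp
        rw [this]; linarith
      · refine (mul_le_mul_right h2 _).trans ?_
        change ENNReal.ofReal _ * _ ≤ _
        rw [← ENNReal.ofReal_mul (by positivity), Real.mul_rpow hρ.le hrm.le]
        apply ENNReal.ofReal_le_ofReal
        have : 1 / (q m * r m ^ s) * ((1 + e m) * q m * (ρ ^ s * r m ^ s)) =
          ρ ^ s + ρ ^ s * e m := by field_simp
        rw [this]; linarith) (by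
      intro R hR ε hε
      filter_upwards [helim.eventually (gt_mem_nhds hε), hbig R] with m hm1 hm2
      have hrm := hr m
      have hqm := hq' m
      have hem := he0 m
      have hrs : 0 < r m ^ s := by positivity
      have hsub : ballH a (R * r m) \ G m (q m) (k m) ⊆ ballH a (t m) \ G m (q m) (k m) := by
        refine sdiff_subset_sdiff_left (ballH_subset ?_)
        rw [dH_self, zero_add, ← hrt m]
        exact mul_le_mul_of_nonneg_right hm2 hrm.le
      refine (mul_le_mul_right ((measure_mono hsub).trans (ht m)) _).trans ?_
      change ENNReal.ofReal _ * _ ≤ _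
      rw [← ENNReal.ofReal_mul (by positivity), ← hrt m, Real.mul_rpow (by positivity) hrm.le]
      apply ENNReal.ofReal_le_ofReal
      have : 1 / (q m * r m ^ s) * (q m * e m / ((m : ℝ) + 1) ^ s *
        (((m : ℝ) + 1) ^ s * r m ^ s)) = e m := by field_simp
      rw [this]; exact hm1.le)
  exact ⟨ν, hν⟩

lemma laplace_analytic {Y V : Type*} [TopologicalSpace Y] [MeasurableSpace Y]
    [OpensMeasurableSpace Y] [SecondCountableTopology Y]
    [NormedAddCommGroup V] [NormedSpace ℝ V] (ν : Measure Y) (B : Y → V →L[ℝ] ℝ)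
    (hB : Continuous B) (w : Y → ℝ) (hw : Continuous w) (hw0 : ∀ y, 0 ≤ w y)
    (hExpInt : ∀ r : ℝ, 0 ≤ r → Integrable (fun y => w y * Real.exp (r * ‖B y‖)) ν) :
    AnalyticOnNhd ℝ (fun v : V => ∫ y, w y * Real.exp (B y v) ∂ν) univ := by
  let P : (k : ℕ) → Y → ContinuousMultilinearMap ℝ (fun _ : Fin k => V) ℝ := fun k y =>
    (w y / k.factorial) • (ContinuousMultilinearMap.mkPiAlgebraFin ℝ k ℝ).compContinuousLinearMap
      (fun _ => B y)
  have hPc : ∀ k, Continuous (P k) := by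
    intro k
    refine (hw.div_const _).smul ?_
    have h1 := (ContinuousMultilinearMap.compContinuousLinearMapContinuousMultilinear ℝ
      (fun _ : Fin k => V) (fun _ : Fin k => ℝ) ℝ).cont
    have h2 : Continuous fun y : Y => (fun _ : Fin k => B y) := continuous_pi fun _ => hB
    exact (h1.comp h2).clm_apply continuous_const
  have hPapp : ∀ k y v, P k y (fun _ => v) = w y * ((B y v) ^ k / k.factorial) := by
    intro k y v
    simp only [P, smul_apply,
      ContinuousMultilinearMap.compContinuousLinearMap_apply,
      ContinuousMultilinearMap.mkPiAlgebraFin_apply, smul_eq_mul]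
    rw [List.ofFn_const, List.prod_replicate]
    ring
  have hPn : ∀ k y, ‖P k y‖ ≤ w y * (‖B y‖ ^ k / k.factorial) := by
    intro k y
    simp only [P]
    rw [norm_smul, Real.norm_of_nonneg (div_nonneg (hw0 y) (by positivity))]
    have h1 := (ContinuousMultilinearMap.mkPiAlgebraFin ℝ k ℝ).norm_compContinuousLinearMap_le
      (fun _ : Fin k => B y)
    rw [ContinuousMultilinearMap.norm_mkPiAlgebraFin, one_mul, Finset.prod_const,
      Finset.card_univ, Fintype.card_fin] at h1
    refine (mul_le_mul_of_nonneg_left h1 (div_nonneg (hw0 y) (by positivity))).trans (le_of_eq ?_)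
    ring
  have hbnd : ∀ (k : ℕ) (r : ℝ), 0 ≤ r → ∀ y, w y * ((r * ‖B y‖) ^ k / k.factorial) ≤
      w y * Real.exp (r * ‖B y‖) := by
    intro k r hr y
    exact mul_le_mul_of_nonneg_left (Real.pow_div_factorial_le_exp _ (by positivity) k) (hw0 y)
  have hBi : ∀ (k : ℕ) (r : ℝ), 0 ≤ r →
      Integrable (fun y => w y * ((r * ‖B y‖) ^ k / k.factorial)) ν := by
    intro k r hr
    refine (hExpInt r hr).mono' ?_ (ae_of_all _ fun y => ?_)
    · exact Continuous.aestronglyMeasurable (by fun_prop)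
    · rw [Real.norm_of_nonneg (mul_nonneg (hw0 y) (by positivity))]
      exact hbnd k r hr y
  have hsum : ∀ r : ℝ, 0 ≤ r →
      Summable fun k : ℕ => ∫ y, w y * ((r * ‖B y‖) ^ k / k.factorial) ∂ν := by
    intro r hr
    refine summable_of_sum_le (c := ∫ y, w y * Real.exp (r * ‖B y‖) ∂ν)
      (fun k => integral_nonneg fun y => mul_nonneg (hw0 y) (by positivity)) fun u => ?_
    rw [← integral_finsetSum _ (fun k _ => hBi k r hr)]
    refine integral_mono (integrable_finsetSum _ fun k _ => hBi k r hr) (hExpInt r hr) fun y => ?_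
    simp only
    rw [← Finset.mul_sum]
    refine mul_le_mul_of_nonneg_left ?_ (hw0 y)
    have h1 := NormedSpace.expSeries_div_hasSum_exp (r * ‖B y‖)
    rw [← Real.exp_eq_exp_ℝ] at h1
    exact sum_le_hasSum u (fun _ _ => by positivity) h1
  have hPi : ∀ k, Integrable (P k) ν := by
    intro k
    refine (hBi k 1 zero_le_one).mono' (hPc k).aestronglyMeasurable (ae_of_all _ fun y => ?_)
    rw [one_mul]; exact hPn k y
  let p : FormalMultilinearSeries ℝ V ℝ := fun k => ∫ y, P k y ∂ν
  have hrad : p.radius = ⊤ := by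
    refine p.radius_eq_top_of_summable_norm fun r => ?_
    refine Summable.of_nonneg_of_le (fun k => by positivity) (fun k => ?_) (hsum r r.2)
    have h1 : ‖p k‖ ≤ ∫ y, w y * (‖B y‖ ^ k / k.factorial) ∂ν := by
      refine norm_integral_le_of_norm_le ?_ (ae_of_all _ (hPn k))
      simpa using hBi k 1 zero_le_one
    refine (mul_le_mul_of_nonneg_right h1 (by positivity)).trans (le_of_eq ?_)
    rw [← integral_mul_const]
    congr 1
    ext y
    ring
  have hps : HasFPowerSeriesOnBall (fun v : V => ∫ y, w y * Real.exp (B y v) ∂ν) p 0 ⊤ := by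
    refine ⟨by rw [hrad], by simp, fun {v} _ => ?_⟩
    have h1 : ∀ k, p k (fun _ => v) = ∫ y, P k y (fun _ => v) ∂ν := fun k =>
      (ContinuousMultilinearMap.integral_apply (hPi k) _)
    have hi : ∀ k, Integrable (fun y => P k y (fun _ => v)) ν := by
      intro k
      refine (hBi k ‖v‖ (norm_nonneg v)).mono' ?_ (ae_of_all _ fun y => ?_)
      · simp_rw [hPapp]
        exact Continuous.aestronglyMeasurable (by fun_prop)
      · rw [hPapp, norm_mul, Real.norm_of_nonneg (hw0 y)]
        refine mul_le_mul_of_nonneg_left ?_ (hw0 y)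
        rw [norm_div, norm_pow, Real.norm_natCast]
        gcongr
        rw [mul_comm]; exact (B y).le_opNorm v
    have hs2 : Summable fun k => ∫ y, ‖P k y (fun _ => v)‖ ∂ν := by
      refine Summable.of_nonneg_of_le (fun k => integral_nonneg fun _ => norm_nonneg _)
        (fun k => ?_) (hsum ‖v‖ (norm_nonneg v))
      refine integral_mono (hi k).norm (hBi k _ (norm_nonneg v)) fun y => ?_
      simp only
      rw [hPapp, norm_mul, Real.norm_of_nonneg (hw0 y)]
      refine mul_le_mul_of_nonneg_left ?_ (hw0 y)
      rw [norm_div, norm_pow, Real.norm_natCast]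
      gcongr
      rw [mul_comm]; exact (B y).le_opNorm v
    have h2 := hasSum_integral_of_summable_integral_norm hi hs2
    simp only [h1, zero_add]
    convert h2 using 1
    congr 1
    ext y
    simp_rw [hPapp]
    have h3 := NormedSpace.expSeries_div_hasSum_exp (B y v)
    rw [← Real.exp_eq_exp_ℝ] at h3
    exact ((h3.mul_left (w y)).tsum_eq).symm
  intro v _
  exact hps.analyticAt_of_mem (by simp)

lemma integrable_exp_neg_K {n : ℕ} {s : ℝ} {ν : Measure (Heis n)} (h : Unif ν s) :
    Integrable (fun y => Real.exp (-KNorm y)) ν := by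
  have hc : Continuous fun y : Heis n => Real.exp (-KNorm y) := by
    have := continuous_KNorm (n := n)
    fun_prop
  refine ⟨hc.aestronglyMeasurable, ?_⟩
  rw [hasFiniteIntegral_iff_enorm]
  have hle : ∀ y : Heis n, ‖Real.exp (-KNorm y)‖ₑ ≤ ∑' j : ℕ,
      (ballH eH ((j : ℝ) + 1)).indicator (fun _ => ENNReal.ofReal (Real.exp (-(j : ℝ)))) y := by
    intro y
    refine le_trans ?_ (ENNReal.le_tsum ⌊KNorm y⌋₊)
    rw [indicator_of_mem]
    · rw [Real.enorm_eq_ofReal (Real.exp_pos _).le]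
      apply ENNReal.ofReal_le_ofReal
      apply Real.exp_le_exp.2
      have := Nat.floor_le (KNorm_nonneg y)
      linarith
    · rw [mem_ballH, dH_eH]
      exact (Nat.lt_floor_add_one _).le
  refine lt_of_le_of_lt (lintegral_mono hle) ?_
  rw [lintegral_tsum (fun j => (measurable_const.indicator (measurableSet_ballH _ _)).aemeasurable)]
  have h1 : ∀ j : ℕ, ∫⁻ y, (ballH eH ((j : ℝ) + 1)).indicator
      (fun _ => ENNReal.ofReal (Real.exp (-(j : ℝ)))) y ∂ν ≤
      ENNReal.ofReal (Real.exp 1 * (((j + 1 : ℕ) : ℝ) ^ (⌈s⌉₊) * Real.exp (-1 * ((j + 1 : ℕ) : ℝ)))) := by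
    intro j
    rw [lintegral_indicator (measurableSet_ballH _ _), setLIntegral_const,
      h.ball eH h.zero _ (by positivity), ← ENNReal.ofReal_mul (Real.exp_pos _).le]
    apply ENNReal.ofReal_le_ofReal
    have e1 : Real.exp (-(j : ℝ)) = Real.exp 1 * Real.exp (-1 * ((j + 1 : ℕ) : ℝ)) := by
      rw [← Real.exp_add]; congr 1; push_cast; ring
    have e2 : ((j : ℝ) + 1) ^ s ≤ ((j + 1 : ℕ) : ℝ) ^ (⌈s⌉₊) := by
      push_cast
      rw [← Real.rpow_natCast]
      apply Real.rpow_le_rpow_of_exponent_le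
      · have : (0 : ℝ) ≤ j := by positivity
        linarith
      · exact Nat.le_ceil s
    rw [e1, mul_assoc, mul_comm (Real.exp (-1 * _))]
    gcongr
  refine lt_of_le_of_lt (ENNReal.tsum_le_tsum h1) ?_
  have hsum : Summable fun j : ℕ =>
      Real.exp 1 * (((j + 1 : ℕ) : ℝ) ^ (⌈s⌉₊) * Real.exp (-1 * ((j + 1 : ℕ) : ℝ))) := by
    refine Summable.mul_left _ ?_
    have := Real.summable_pow_mul_exp_neg_nat_mul ⌈s⌉₊ (r := 1) one_pos
    exact (_root_.summable_nat_add_iff 1).2 this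
  rw [← ENNReal.ofReal_tsum_of_nonneg (fun j => by positivity) hsum]
  exact ENNReal.ofReal_lt_top

lemma poly_bound {C lam : ℝ} (hC : 0 ≤ C) (hl : 0 < lam) :
    ∃ D : ℝ, ∀ K : ℝ, 0 ≤ K → C * (1 + K) ^ 3 - lam * K ^ 4 ≤ D - K := by
  set M := 8 * C + 1 with hM
  have hM0 : 0 < M := by positivity
  refine ⟨M + M * (M / lam) ^ 3, fun K hK => ?_⟩
  have h4 : 0 ≤ lam * K ^ 4 := by positivity
  have h5 : 0 ≤ M * (M / lam) ^ 3 := by positivity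
  rcases le_or_gt K 1 with h1 | h1
  · have : (1 + K) ^ 3 ≤ 2 ^ 3 := by gcongr; linarith
    nlinarith
  · have h2 : (1 + K) ^ 3 ≤ (2 * K) ^ 3 := by gcongr; linarith
    have h3 : K ≤ K ^ 3 := le_self_pow₀ h1.le (by norm_num)
    have h6 : C * (1 + K) ^ 3 + K ≤ M * K ^ 3 := by
      rw [hM]; nlinarith
    have h7 : M * K ^ 3 ≤ lam * K ^ 4 + M * (M / lam) ^ 3 := by
      rcases le_or_gt K (M / lam) with h8 | h8
      · have : M * K ^ 3 ≤ M * (M / lam) ^ 3 := by gcongr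
        linarith
      · rw [div_lt_iff₀ hl] at h8
        have : M * K ^ 3 ≤ (K * lam) * K ^ 3 := by gcongr
        nlinarith
    linarith

lemma integrable_exp_K {n : ℕ} {s : ℝ} {ν : Measure (Heis n)} (h : Unif ν s) {C lam : ℝ}
    (hC : 0 ≤ C) (hl : 0 < lam) :
    Integrable (fun y => Real.exp (C * (1 + KNorm y) ^ 3 - lam * KNorm y ^ 4)) ν := by
  obtain ⟨D, hD⟩ := poly_bound hC hl
  refine ((integrable_exp_neg_K h).const_mul (Real.exp D)).mono' ?_ (ae_of_all _ fun y => ?_)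
  · have := continuous_KNorm (n := n)
    exact Continuous.aestronglyMeasurable (by fun_prop)
  · rw [Real.norm_of_nonneg (Real.exp_pos _).le, ← Real.exp_add]
    exact Real.exp_le_exp.2 (by linarith [hD _ (KNorm_nonneg y)])

/-- The heat-like kernel transform of `ν`. -/
def Fk {n : ℕ} (ν : Measure (Heis n)) (lam : ℝ) (x : Heis n) : ℝ :=
  ∫ y, Real.exp (-lam * dH x y ^ 4) ∂ν

lemma map_dist_eq {n : ℕ} {s : ℝ} (hs : 0 < s) {ν : Measure (Heis n)} (h : Unif ν s)
    {x z : Heis n} (hx : x ∈ suppH ν) (hz : z ∈ suppH ν) :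
    ν.map (fun y => dH x y) = ν.map (fun y => dH z y) := by
  have hb : ∀ u ∈ suppH ν, ∀ r, ν (ballH u r) = ENNReal.ofReal (if 0 < r then r ^ s else 0) := by
    intro u hu r
    split_ifs with hr
    · exact h.ball u hu r hr
    · rw [ENNReal.ofReal_zero, ← nonpos_iff_eq_zero]
      have ht : Tendsto (fun ε : ℝ => ENNReal.ofReal (ε ^ s)) (𝓝[>] 0)
          (𝓝 (ENNReal.ofReal ((0 : ℝ) ^ s))) := by
        apply ENNReal.tendsto_ofReal
        apply tendsto_nhdsWithin_of_tendsto_nhds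
        exact (continuous_id.rpow_const fun x => Or.inr hs.le).tendsto 0
      rw [Real.zero_rpow hs.ne', ENNReal.ofReal_zero] at ht
      refine ge_of_tendsto ht ?_
      filter_upwards [self_mem_nhdsWithin] with ε hε
      have hε' : 0 < ε := hε
      rw [← h.ball u hu ε hε]
      exact measure_mono (ballH_subset (by rw [dH_self]; linarith))
  have hI : ∀ u ∈ suppH ν, ∀ a b : ℝ, a < b → (ν.map (fun y => dH u y)) (Ioc a b) =
      ENNReal.ofReal (if 0 < b then b ^ s else 0) - ENNReal.ofReal (if 0 < a then a ^ s else 0) := by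
    intro u hu a b hab
    rw [Measure.map_apply (continuous_dH_right u).measurable measurableSet_Ioc]
    have : (fun y => dH u y) ⁻¹' Ioc a b = ballH u b \ ballH u a := by
      ext y
      simp only [mem_preimage, mem_Ioc, Set.mem_sdiff, mem_ballH, not_le, and_comm]
    rw [this, measure_sdiff (ballH_subset (by rw [dH_self]; linarith))
      (measurableSet_ballH _ _).nullMeasurableSet (by rw [hb u hu]; exact ENNReal.ofReal_ne_top),
      hb u hu, hb u hu]
  refine Measure.ext_of_Ioc' _ _ (fun a b hab => ?_) (fun a b hab => ?_)
  · rw [hI x hx a b hab]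
    exact ne_top_of_le_ne_top ENNReal.ofReal_ne_top tsub_le_self
  · rw [hI x hx a b hab, hI z hz a b hab]

lemma Fk_const {n : ℕ} {s : ℝ} (hs : 0 < s) {ν : Measure (Heis n)} (h : Unif ν s) (lam : ℝ)
    {x z : Heis n} (hx : x ∈ suppH ν) (hz : z ∈ suppH ν) : Fk ν lam x = Fk ν lam z := by
  have e : ∀ u : Heis n, Fk ν lam u = ∫ t, Real.exp (-lam * t ^ 4) ∂(ν.map (fun y => dH u y)) := by
    intro u
    rw [integral_map (continuous_dH_right u).measurable.aemeasurable
      (Continuous.aestronglyMeasurable (by fun_prop))]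
    rfl
  rw [e, e, map_dist_eq hs h hx hz]

lemma integrable_Fk {n : ℕ} {s : ℝ} {ν : Measure (Heis n)} (h : Unif ν s) {lam : ℝ}
    (hl : 0 < lam) (x : Heis n) : Integrable (fun y => Real.exp (-lam * dH x y ^ 4)) ν := by
  have hK : ∀ y : Heis n, KNorm y ^ 4 ≤ 8 * (KNorm x ^ 4 + dH x y ^ 4) := by
    intro y
    have h1 := dH_triangle eH x y
    rw [dH_eH, dH_eH] at h1
    have h2 := KNorm_nonneg x
    have h3 := dH_nonneg x y
    have h4 : KNorm y ^ 4 ≤ (KNorm x + dH x y) ^ 4 := by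
      have := KNorm_nonneg y
      gcongr
    have h5 := add_pow_le h2 h3 4
    norm_num at h5
    linarith
  have h1 := (integrable_exp_K h le_rfl (show 0 < lam / 8 by positivity)).const_mul
    (Real.exp (lam * KNorm x ^ 4))
  refine h1.mono' ?_ (ae_of_all _ fun y => ?_)
  · have := continuous_dH_right x
    exact Continuous.aestronglyMeasurable (by fun_prop)
  · rw [Real.norm_of_nonneg (Real.exp_pos _).le, ← Real.exp_add]
    apply Real.exp_le_exp.2
    have := mul_le_mul_of_nonneg_left (hK y) hl.le
    linarith

/-- Index set of monomials appearing in the expansion of the kernel. -/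
abbrev Idx (n : ℕ) := (Fin (2 * n) × Fin (2 * n)) ⊕ (Fin (2 * n) ⊕ (Fin (2 * n) ⊕
  (Fin (2 * n) ⊕ (Unit ⊕ Unit))))

/-- Coefficients depending on `x`. -/
def aF {n : ℕ} (lam : ℝ) (x : Heis n) : Idx n → ℝ :=
  Sum.elim (fun p => -lam * (4 * (x.1 p.1 * x.1 p.2) + (JL n x.1) p.1 * (JL n x.1) p.2))
    (Sum.elim (fun i => -lam * (-4 * (‖x.1‖ ^ 2 * x.1 i) + 2 * (x.2 * (JL n x.1) i)))
      (Sum.elim (fun i => -lam * (-4 * x.1 i))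
        (Sum.elim (fun i => -lam * (-2 * (JL n x.1) i))
          (Sum.elim (fun _ => -lam * (2 * ‖x.1‖ ^ 2)) (fun _ => -lam * (-2 * x.2))))))

/-- Monomials in `y`. -/
def bF {n : ℕ} (y : Heis n) : Idx n → ℝ :=
  Sum.elim (fun p => y.1 p.1 * y.1 p.2)
    (Sum.elim (fun i => y.1 i)
      (Sum.elim (fun i => ‖y.1‖ ^ 2 * y.1 i)
        (Sum.elim (fun i => y.2 * y.1 i)
          (Sum.elim (fun _ => ‖y.1‖ ^ 2) (fun _ => y.2)))))

lemma sum_aF_bF {n : ℕ} (lam : ℝ) (x y : Heis n) :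
    ∑ i, bF y i * aF lam x i = -lam * dH x y ^ 4 + lam * KNorm x ^ 4 + lam * KNorm y ^ 4 := by
  have hp : ⟪x.1, y.1⟫ = ∑ i, y.1 i * x.1 i := by
    simp [PiLp.inner_apply]
  have hσ : symp x.1 y.1 = ∑ i, y.1 i * (JL n x.1) i := by
    rw [symp_eq]; simp [PiLp.inner_apply]
  have hpp : ∑ i, ∑ j, (y.1 i * y.1 j) * (x.1 i * x.1 j) = ⟪x.1, y.1⟫ ^ 2 := by
    rw [hp, sq, Finset.sum_mul_sum]
    refine Finset.sum_congr rfl fun i _ => Finset.sum_congr rfl fun j _ => by ring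
  have hσσ : ∑ i, ∑ j, (y.1 i * y.1 j) * ((JL n x.1) i * (JL n x.1) j) = symp x.1 y.1 ^ 2 := by
    rw [hσ, sq, Finset.sum_mul_sum]
    refine Finset.sum_congr rfl fun i _ => Finset.sum_congr rfl fun j _ => by ring
  rw [dH_pow, KNorm_pow, KNorm_pow, norm_sub_sq_real]
  simp only [Idx, Fintype.sum_sum_type, aF, bF, Sum.elim_inl, Sum.elim_inr, Fintype.sum_prod_type,
    Finset.univ_unique, Finset.sum_singleton]
  have e1 : ∑ i, ∑ j, y.1 i * y.1 j * (-lam * (4 * (x.1 i * x.1 j) + (JL n x.1) i * (JL n x.1) j))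
      = -lam * (4 * ⟪x.1, y.1⟫ ^ 2 + symp x.1 y.1 ^ 2) := by
    rw [← hpp, ← hσσ]
    simp only [Finset.mul_sum, ← Finset.sum_add_distrib]
    refine Finset.sum_congr rfl fun i _ => Finset.sum_congr rfl fun j _ => by ring
  have e2 : ∑ i, y.1 i * (-lam * (-4 * (‖x.1‖ ^ 2 * x.1 i) + 2 * (x.2 * (JL n x.1) i)))
      = -lam * (-4 * ‖x.1‖ ^ 2 * ⟪x.1, y.1⟫ + 2 * x.2 * symp x.1 y.1) := by
    rw [hp, hσ]
    simp only [Finset.mul_sum, ← Finset.sum_add_distrib]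
    refine Finset.sum_congr rfl fun i _ => by ring
  have e3 : ∑ i, ‖y.1‖ ^ 2 * y.1 i * (-lam * (-4 * x.1 i)) =
      -lam * (-4 * ‖y.1‖ ^ 2 * ⟪x.1, y.1⟫) := by
    rw [hp]
    simp only [Finset.mul_sum]
    refine Finset.sum_congr rfl fun i _ => by ring
  have e4 : ∑ i, y.2 * y.1 i * (-lam * (-2 * (JL n x.1) i)) =
      -lam * (-2 * y.2 * symp x.1 y.1) := by
    rw [hσ]
    simp only [Finset.mul_sum]
    refine Finset.sum_congr rfl fun i _ => by ring
  rw [e1, e2, e3, e4]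
  ring

lemma contDiff_aF {n : ℕ} (lam : ℝ) : ContDiff ℝ ω (aF lam : Heis n → Idx n → ℝ) := by
  have hx : ∀ i, ContDiff ℝ ω fun x : Heis n => x.1 i := fun i =>
    (EuclideanSpace.proj (𝕜 := ℝ) i : EE n →L[ℝ] ℝ).contDiff.comp contDiff_fst
  have hJ : ∀ i, ContDiff ℝ ω fun x : Heis n => (JL n x.1) i := fun i =>
    ((EuclideanSpace.proj (𝕜 := ℝ) i : EE n →L[ℝ] ℝ).contDiff.comp (JL n).contDiff).comp contDiff_fst
  have hN : ContDiff ℝ ω fun x : Heis n => ‖x.1‖ ^ 2 := contDiff_fst.norm_sq ℝ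
  have h2 : ContDiff ℝ ω fun x : Heis n => x.2 := contDiff_snd
  rw [contDiff_pi]
  rintro (p | i | i | i | u | u) <;> simp only [aF, Sum.elim_inl, Sum.elim_inr]
  · exact contDiff_const.mul ((contDiff_const.mul ((hx _).mul (hx _))).add ((hJ _).mul (hJ _)))
  · exact contDiff_const.mul ((contDiff_const.mul (hN.mul (hx _))).add
      (contDiff_const.mul (h2.mul (hJ _))))
  · exact contDiff_const.mul (contDiff_const.mul (hx _))
  · exact contDiff_const.mul (contDiff_const.mul (hJ _))
  · exact contDiff_const.mul (contDiff_const.mul hN)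
  · exact contDiff_const.mul (contDiff_const.mul h2)

lemma continuous_bF {n : ℕ} : Continuous (bF : Heis n → Idx n → ℝ) := by
  refine continuous_pi ?_
  rintro (p | i | i | i | u | u) <;> simp only [bF, Sum.elim_inl, Sum.elim_inr] <;> fun_prop

lemma abs_bF_le {n : ℕ} (y : Heis n) (i : Idx n) : |bF y i| ≤ (1 + KNorm y) ^ 3 := by
  have hK := KNorm_nonneg y
  have h1 : ‖y.1‖ ≤ KNorm y := norm_fst_le_KNorm y
  have h2 := abs_snd_le_KNorm y
  have h3 : ∀ i, |y.1 i| ≤ KNorm y := fun i => by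
    have := PiLp.norm_apply_le y.1 i
    rw [Real.norm_eq_abs] at this
    exact this.trans h1
  have hN : ‖y.1‖ ^ 2 ≤ KNorm y ^ 2 := by gcongr
  have b1 : KNorm y ≤ (1 + KNorm y) ^ 3 := by nlinarith [pow_nonneg hK 3, pow_nonneg hK 2]
  have b2 : KNorm y ^ 2 ≤ (1 + KNorm y) ^ 3 := by nlinarith [pow_nonneg hK 3, pow_nonneg hK 2]
  have b3 : KNorm y ^ 2 * KNorm y ≤ (1 + KNorm y) ^ 3 := by
    nlinarith [pow_nonneg hK 3, pow_nonneg hK 2]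
  rcases i with (p | i | i | i | u | u) <;> simp only [bF, Sum.elim_inl, Sum.elim_inr]
  · rw [abs_mul]
    refine le_trans ?_ b2
    rw [sq]
    exact mul_le_mul (h3 _) (h3 _) (abs_nonneg _) hK
  · exact (h3 i).trans b1
  · rw [abs_mul, abs_of_nonneg (by positivity)]
    exact (mul_le_mul hN (h3 _) (abs_nonneg _) (by positivity)).trans b3
  · rw [abs_mul]
    exact (mul_le_mul h2 (h3 _) (abs_nonneg _) (by positivity)).trans b3
  · rw [abs_of_nonneg (by positivity)]
    exact hN.trans b2
  · exact h2.trans b2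

lemma contDiff_Fk {n : ℕ} {s : ℝ} {ν : Measure (Heis n)} (h : Unif ν s) {lam : ℝ}
    (hl : 0 < lam) : ContDiff ℝ ω (Fk ν lam) := by
  let B : Heis n → (Idx n → ℝ) →L[ℝ] ℝ := fun y =>
    ∑ i, bF y i • (ContinuousLinearMap.proj i : (Idx n → ℝ) →L[ℝ] ℝ)
  have hBa : ∀ y v, B y v = ∑ i, bF y i * v i := by
    intro y v
    simp [B]
  have hB : Continuous B := by
    refine continuous_finsetSum _ fun i _ => ?_
    exact ((continuous_apply i).comp continuous_bF).smul continuous_const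
  have hKc := continuous_KNorm (n := n)
  have hBn : ∀ y, ‖B y‖ ≤ Fintype.card (Idx n) * (1 + KNorm y) ^ 3 := by
    intro y
    have hK := KNorm_nonneg y
    refine ContinuousLinearMap.opNorm_le_bound _ (by positivity) fun v => ?_
    rw [hBa]
    refine (norm_sum_le _ _).trans ?_
    calc ∑ i, ‖bF y i * v i‖ ≤ ∑ i : Idx n, (1 + KNorm y) ^ 3 * ‖v‖ := by
          refine Finset.sum_le_sum fun i _ => ?_
          rw [norm_mul]
          exact mul_le_mul (abs_bF_le y i) (norm_le_pi_norm v i) (norm_nonneg _) (by positivity)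
      _ = _ := by
          rw [Finset.sum_const, Finset.card_univ, nsmul_eq_mul, mul_assoc]
  have hL := laplace_analytic ν B hB (fun y => Real.exp (-lam * KNorm y ^ 4)) (by fun_prop)
    (fun y => (Real.exp_pos _).le) (by
      intro r hr
      refine (integrable_exp_K h (C := r * Fintype.card (Idx n)) (by positivity) hl).mono' ?_
        (ae_of_all _ fun y => ?_)
      · exact Continuous.aestronglyMeasurable (by fun_prop)
      · rw [Real.norm_of_nonneg (by positivity), ← Real.exp_add]
        apply Real.exp_le_exp.2
        have := mul_le_mul_of_nonneg_left (hBn y) hr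
        linarith)
  have hL2 : ContDiff ℝ ω (fun v => ∫ y, Real.exp (-lam * KNorm y ^ 4) * Real.exp (B y v) ∂ν) := by
    rw [← contDiffOn_univ]
    exact hL.contDiffOn uniqueDiffOn_univ
  have e : Fk ν lam = fun x => Real.exp (-lam * (((‖x.1‖ ^ 2) ^ 2) + x.2 ^ 2)) *
      (∫ y, Real.exp (-lam * KNorm y ^ 4) * Real.exp (B y (aF lam x)) ∂ν) := by
    ext x
    rw [Fk, ← integral_const_mul]
    congr 1
    ext y
    rw [← Real.exp_add, ← Real.exp_add, hBa, sum_aF_bF]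
    congr 1
    rw [KNorm_pow x]
    ring
  rw [e]
  refine ContDiff.mul ?_ (hL2.comp (contDiff_aF lam))
  refine ContDiff.exp (contDiff_const.mul (((contDiff_fst.norm_sq ℝ).pow 2).add (contDiff_snd.pow 2)))

/-- Left-invariant horizontal vector field in direction `w`. -/
def Xop {n : ℕ} (w : EE n) (f : Heis n → ℝ) (x : Heis n) : ℝ := fderiv ℝ f x (w, symp x.1 w)

/-- Vertical derivative. -/
def Tvert {n : ℕ} (f : Heis n → ℝ) (x : Heis n) : ℝ := fderiv ℝ f x (0, 1)

lemma contDiff_symp {n : ℕ} : ContDiff ℝ ω (fun p : EE n × EE n => symp p.1 p.2) := by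
  simp_rw [symp_eq]
  exact ((JL n).contDiff.comp contDiff_fst).inner ℝ contDiff_snd

lemma contDiff_fderiv {n : ℕ} {G : Type*} [NormedAddCommGroup G] [NormedSpace ℝ G]
    {f : Heis n → G} (hf : ContDiff ℝ ω f) :
    ContDiff ℝ ω (fderiv ℝ f) := hf.fderiv_right (by simp)

lemma contDiff_Xop {n : ℕ} {f : Heis n → ℝ} (hf : ContDiff ℝ ω f) (w : EE n) :
    ContDiff ℝ ω (Xop w f) := by
  refine (contDiff_fderiv hf).clm_apply (contDiff_const.prodMk ?_)
  exact contDiff_symp.comp (contDiff_fst.prodMk contDiff_const)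

lemma contDiff_Tvert {n : ℕ} {f : Heis n → ℝ} (hf : ContDiff ℝ ω f) :
    ContDiff ℝ ω (Tvert f) :=
  (contDiff_fderiv hf).clm_apply contDiff_const

lemma fderiv_vert {n : ℕ} (f : Heis n → ℝ) (x : Heis n) (w : EE n) (t : ℝ) :
    fderiv ℝ f x (w, symp x.1 w + t) = Xop w f x + t * Tvert f x := by
  have : ((w, symp x.1 w + t) : Heis n) = (w, symp x.1 w) + t • (0, 1) := by
    ext <;> simp
  rw [this, map_add, map_smul]
  rfl

lemma hasDerivAt_symp_left {n : ℕ} (w : EE n) (z : Heis n) :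
    HasFDerivAt (fun z : Heis n => ((w, symp z.1 w) : Heis n))
      ((0 : Heis n →L[ℝ] EE n).prod (((innerSL ℝ w).comp (JL n)).comp
        (ContinuousLinearMap.fst ℝ (EE n) ℝ))) z := by
  refine (hasFDerivAt_const w z).prodMk ?_
  have h := (((innerSL ℝ w).comp (JL n)).comp (ContinuousLinearMap.fst ℝ (EE n) ℝ)).hasFDerivAt
    (x := z)
  have e : (fun z : Heis n => symp z.1 w) =
      ⇑(((innerSL ℝ w).comp (JL n)).comp (ContinuousLinearMap.fst ℝ (EE n) ℝ)) := by
    funext z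
    simp [symp_eq, real_inner_comm]
  rw [e]
  exact h

lemma fderiv_Xop {n : ℕ} {f : Heis n → ℝ} (hf : ContDiff ℝ ω f) (w : EE n) (z v : Heis n) :
    fderiv ℝ (Xop w f) z v = fderiv ℝ (fderiv ℝ f) z v (w, symp z.1 w) +
      symp v.1 w * Tvert f z := by
  have h1 : HasFDerivAt (fderiv ℝ f) (fderiv ℝ (fderiv ℝ f) z) z :=
    ((contDiff_fderiv hf).differentiable (by simp) z).hasFDerivAt
  have h2 := h1.clm_apply (hasDerivAt_symp_left w z)
  have h3 : fderiv ℝ (Xop w f) z = _ := h2.fderiv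
  rw [h3]
  simp only [add_apply, ContinuousLinearMap.comp_apply,
    ContinuousLinearMap.flip_apply, ContinuousLinearMap.prod_apply,
    zero_apply, ContinuousLinearMap.coe_fst', innerSL_apply_apply]
  have : ((0, ⟪w, JL n v.1⟫) : Heis n) = symp v.1 w • (0, 1) := by
    ext <;> simp [symp_eq, real_inner_comm]
  rw [this, map_smul, add_comm]
  rfl

lemma Xop_comm {n : ℕ} {f : Heis n → ℝ} (hf : ContDiff ℝ ω f) (v w : EE n) (z : Heis n) :
    Xop v (Xop w f) z - Xop w (Xop v f) z = 2 * symp v w * Tvert f z := by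
  have hsymm : IsSymmSndFDerivAt ℝ f z := by
    apply hf.contDiffAt.isSymmSndFDerivAt
    simp
  rw [Xop, fderiv_Xop hf, Xop, fderiv_Xop hf, hsymm.eq]
  simp only
  rw [symp_swap v w]
  ring

/-- Curve `r ↦ x · δ_r k`. -/
lemma hasDerivAt_curve {n : ℕ} {f : Heis n → ℝ} (hf : ContDiff ℝ ω f) (x k : Heis n) (r : ℝ) :
    HasDerivAt (fun r => f (hmul x (dil r k)))
      (Xop k.1 f (hmul x (dil r k)) + 2 * r * k.2 * Tvert f (hmul x (dil r k))) r := by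
  have hγ : HasDerivAt (fun r => hmul x (dil r k)) (k.1, symp x.1 k.1 + 2 * r * k.2) r := by
    have e : (fun r : ℝ => hmul x (dil r k)) =
        fun r => (x.1 + r • k.1, x.2 + r ^ 2 * k.2 + r * symp x.1 k.1) := by
      ext r <;> simp [hmul, dil, symp_smul_right]
    rw [e]
    refine HasDerivAt.prodMk ?_ ?_
    · simpa using ((hasDerivAt_id r).smul_const k.1).const_add x.1
    · have h1 : HasDerivAt (fun r : ℝ => x.2 + r ^ 2 * k.2 + r * symp x.1 k.1)
          ((2 * r) * k.2 + 1 * symp x.1 k.1) r := by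
        refine HasDerivAt.add (HasDerivAt.const_add _ (HasDerivAt.mul_const ?_ _))
          ((hasDerivAt_id r).mul_const _)
        simpa using hasDerivAt_pow 2 r
      exact h1.congr_deriv (by ring)
  have h2 := ((hf.differentiable (by simp) (hmul x (dil r k))).hasFDerivAt).comp_hasDerivAt r hγ
  refine h2.congr_deriv ?_
  have : symp x.1 k.1 = symp (hmul x (dil r k)).1 k.1 := by
    simp [hmul, dil, symp_add_left, symp_smul_left, symp_self]
  rw [this, fderiv_vert]

lemma curve_zero {n : ℕ} (x k : Heis n) : hmul x (dil 0 k) = x := by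
  simp [hmul, dil, symp_zero_right]

/-- Real-analytic functions vanishing on the support. -/
def InI {n : ℕ} (ν : Measure (Heis n)) (f : Heis n → ℝ) : Prop :=
  ContDiff ℝ ω f ∧ ∀ x ∈ suppH ν, f x = 0

/-- Tangent sequence at `x` with limit `y`. -/
structure TSeq {n : ℕ} (ν : Measure (Heis n)) (x y : Heis n) (r : ℕ → ℝ) (k : ℕ → Heis n) :
    Prop where
  pos : ∀ m, 0 < r m
  lim : Tendsto r atTop (𝓝 0)
  klim : Tendsto k atTop (𝓝 y)
  mem : ∀ m, hmul x (dil (r m) (k m)) ∈ suppH ν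

lemma continuous_curve {n : ℕ} (x : Heis n) :
    Continuous fun p : ℝ × Heis n => hmul x (dil p.1 p.2) := by
  have : Continuous fun p : ℝ × Heis n => dil p.1 p.2 := by
    unfold dil; fun_prop
  exact (continuous_hmul_left x).comp this

lemma rolle_curve {n : ℕ} {ν : Measure (Heis n)} {f : Heis n → ℝ} (hf : InI ν f)
    {x k : Heis n} (hx : x ∈ suppH ν) {r : ℝ} (hr : 0 < r) (hk : hmul x (dil r k) ∈ suppH ν) :
    ∃ c ∈ Ioo 0 r, Xop k.1 f (hmul x (dil c k)) + 2 * c * k.2 * Tvert f (hmul x (dil c k)) = 0 := by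
  refine exists_hasDerivAt_eq_zero (f := fun r => f (hmul x (dil r k))) hr ?_ ?_
    (fun c _ => hasDerivAt_curve hf.1 x k c)
  · exact fun c _ => (hasDerivAt_curve hf.1 x k c).continuousAt.continuousWithinAt
  · simp only [curve_zero]
    rw [hf.2 x hx, hf.2 _ hk]

lemma tangent_first {n : ℕ} {ν : Measure (Heis n)} {f : Heis n → ℝ} (hf : InI ν f)
    {x y : Heis n} (hx : x ∈ suppH ν) {r : ℕ → ℝ} {k : ℕ → Heis n} (h : TSeq ν x y r k) :
    Xop y.1 f x = 0 := by
  choose c hc hc2 using fun m => rolle_curve hf hx (h.pos m) (h.mem m)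
  have hc0 : Tendsto c atTop (𝓝 0) :=
    squeeze_zero (fun m => (hc m).1.le) (fun m => (hc m).2.le) h.lim
  let Φ : ℝ × Heis n → ℝ := fun p => Xop p.2.1 f (hmul x (dil p.1 p.2)) +
    2 * p.1 * p.2.2 * Tvert f (hmul x (dil p.1 p.2))
  have hΦ : Continuous Φ := by
    have h1 := continuous_curve x
    have h2 := (contDiff_fderiv hf.1).continuous
    have h3 := (contDiff_Tvert hf.1).continuous
    refine Continuous.add ?_ ((by fun_prop : Continuous fun p : ℝ × Heis n => 2 * p.1 * p.2.2).mul
      (h3.comp h1))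
    refine (h2.comp h1).clm_apply (Continuous.prodMk (by fun_prop) ?_)
    exact contDiff_symp.continuous.comp ((continuous_fst.comp h1).prodMk (by fun_prop))
  have hlim := (hΦ.tendsto (0, y)).comp (hc0.prodMk_nhds h.klim)
  have hz : Φ ∘ (fun m => (c m, k m)) = fun _ => 0 := funext hc2
  rw [hz] at hlim
  have := tendsto_nhds_unique hlim tendsto_const_nhds
  simpa [Φ, curve_zero] using this

lemma tangent_second {n : ℕ} {ν : Measure (Heis n)} {f : Heis n → ℝ} (hf : InI ν f)
    {W : Submodule ℝ (EE n)} (hX : ∀ w ∈ W, InI ν (Xop w f))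
    (hXX : ∀ w ∈ W, InI ν (Xop w (Xop w f)))
    {x y : Heis n} (hx : x ∈ suppH ν) {r : ℕ → ℝ} {k : ℕ → Heis n} (h : TSeq ν x y r k)
    (hkW : ∀ m, (k m).1 ∈ W) (hyW : y.1 ∈ W) :
    y.2 * Tvert f x = 0 := by
  choose c hc hc2 using fun m => rolle_curve hf hx (h.pos m) (h.mem m)
  have hc0 : Tendsto c atTop (𝓝 0) :=
    squeeze_zero (fun m => (hc m).1.le) (fun m => (hc m).2.le) h.lim
  have hmv : ∀ m, ∃ ξ ∈ Ioo 0 (c m), Xop (k m).1 (Xop (k m).1 f) (hmul x (dil ξ (k m))) +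
      2 * ξ * (k m).2 * Tvert (Xop (k m).1 f) (hmul x (dil ξ (k m))) +
      2 * (k m).2 * Tvert f (hmul x (dil (c m) (k m))) = 0 := by
    intro m
    have hd := fun t => hasDerivAt_curve (hX _ (hkW m)).1 x (k m) t
    obtain ⟨ξ, hξ, he⟩ := exists_hasDerivAt_eq_slope
      (fun t => Xop (k m).1 f (hmul x (dil t (k m)))) _ (hc m).1
      (fun t _ => (hd t).continuousAt.continuousWithinAt) (fun t _ => hd t)
    refine ⟨ξ, hξ, ?_⟩
    rw [he, curve_zero, (hX _ (hkW m)).2 x hx, sub_zero, sub_zero]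
    have h0 := (hc m).1
    have h3 : Xop (k m).1 f (hmul x (dil (c m) (k m))) =
      -(2 * c m * (k m).2 * Tvert f (hmul x (dil (c m) (k m)))) := by linarith [hc2 m]
    rw [h3]
    field_simp
    ring
  choose ξ hξ hξ2 using hmv
  have hξ0 : Tendsto ξ atTop (𝓝 0) :=
    squeeze_zero (fun m => (hξ m).1.le) (fun m => (hξ m).2.le) hc0
  have h1 := continuous_curve x
  have h2 := (contDiff_fderiv (contDiff_fderiv hf.1)).continuous
  have h3 := (contDiff_Tvert hf.1).continuous
  let Φ : (ℝ × ℝ) × Heis n → ℝ := fun p =>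
    fderiv ℝ (fderiv ℝ f) (hmul x (dil p.1.1 p.2))
      (p.2.1, symp (hmul x (dil p.1.1 p.2)).1 p.2.1)
      (p.2.1, symp (hmul x (dil p.1.1 p.2)).1 p.2.1) +
    2 * p.1.1 * p.2.2 * fderiv ℝ (fderiv ℝ f) (hmul x (dil p.1.1 p.2)) (0, 1)
      (p.2.1, symp (hmul x (dil p.1.1 p.2)).1 p.2.1) +
    2 * p.2.2 * Tvert f (hmul x (dil p.1.2 p.2))
  have hΦ : Continuous Φ := by
    have g1 : Continuous fun p : (ℝ × ℝ) × Heis n => hmul x (dil p.1.1 p.2) :=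
      h1.comp (by fun_prop : Continuous fun p : (ℝ × ℝ) × Heis n => (p.1.1, p.2))
    have g2 : Continuous fun p : (ℝ × ℝ) × Heis n => hmul x (dil p.1.2 p.2) :=
      h1.comp (by fun_prop : Continuous fun p : (ℝ × ℝ) × Heis n => (p.1.2, p.2))
    have g3 : Continuous fun p : (ℝ × ℝ) × Heis n =>
        ((p.2.1, symp (hmul x (dil p.1.1 p.2)).1 p.2.1) : Heis n) :=
      Continuous.prodMk (by fun_prop)
        (contDiff_symp.continuous.comp ((continuous_fst.comp g1).prodMk (by fun_prop)))
    have g4 := h2.comp g1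
    refine ((((g4.clm_apply g3).clm_apply g3)).add (Continuous.mul (by fun_prop)
      ((g4.clm_apply continuous_const).clm_apply g3))).add (Continuous.mul (by fun_prop) (h3.comp g2))
  have hlim := (hΦ.tendsto ((0, 0), y)).comp ((hξ0.prodMk_nhds hc0).prodMk_nhds h.klim)
  have hz : Φ ∘ (fun m => ((ξ m, c m), k m)) = fun _ => 0 := by
    funext m
    rw [← hξ2 m]
    simp only [Φ, Function.comp]
    have hT : Tvert (Xop (k m).1 f) (hmul x (dil (ξ m) (k m))) =
      fderiv ℝ (Xop (k m).1 f) (hmul x (dil (ξ m) (k m))) (0, 1) := rfl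
    rw [hT, Xop, fderiv_Xop hf.1, fderiv_Xop hf.1]
    simp [symp_self, symp_zero_left]
  rw [hz] at hlim
  have h5 := tendsto_nhds_unique hlim tendsto_const_nhds
  have h6 := (hXX y.1 hyW).2 x hx
  rw [Xop, fderiv_Xop hf.1] at h6
  simp only [symp_self, zero_mul, add_zero] at h6
  simp only [Φ, curve_zero, h6] at h5
  linarith

lemma line_zero {n : ℕ} {ν : Measure (Heis n)} (h0 : eH ∈ suppH ν) (v : Heis n)
    (hD : ∀ f, InI ν f → InI ν (fun x => Xop v.1 f x + v.2 * Tvert f x))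
    {f : Heis n → ℝ} (hf : InI ν f) : f v = 0 := by
  have hder : ∀ f, InI ν f → deriv (fun τ : ℝ => f (τ • v)) =
      fun τ : ℝ => (fun x => Xop v.1 f x + v.2 * Tvert f x) (τ • v) := by
    intro f hf
    funext τ
    have hγ : HasDerivAt (fun τ : ℝ => τ • v) v τ := by
      simpa using (hasDerivAt_id τ).smul_const v
    have h2 := ((hf.1.differentiable (by simp) (τ • v)).hasFDerivAt).comp_hasDerivAt τ hγ
    have h3 : deriv (fun τ : ℝ => f (τ • v)) τ = fderiv ℝ f (τ • v) v := h2.deriv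
    rw [h3]
    have h4 : v = (v.1, symp (τ • v).1 v.1 + v.2) := by
      ext <;> simp [symp_smul_left, symp_self]
    have h5 := fderiv_vert f (τ • v) v.1 v.2
    rw [← h4] at h5
    exact h5
  have hit : ∀ k, ∀ f, InI ν f → iteratedDeriv k (fun τ : ℝ => f (τ • v)) 0 = 0 := by
    intro k
    induction k with
    | zero =>
      intro f hf
      have := hf.2 eH h0
      simpa [eH, ← Prod.zero_eq_mk] using this
    | succ k ih =>
      intro f hf
      rw [iteratedDeriv_succ', hder f hf]
      exact ih _ (hD f hf)
  have hg : ContDiff ℝ ω (fun τ : ℝ => f (τ • v)) := hf.1.comp (by fun_prop)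
  have hga : AnalyticOnNhd ℝ (fun τ : ℝ => f (τ • v)) univ := fun x _ =>
    hg.contDiffAt.analyticAt
  have hp := (hga 0 (mem_univ _)).hasFPowerSeriesAt
  have hz : (fun n => iteratedDeriv n (fun τ : ℝ => f (τ • v)) 0 / (n.factorial : ℝ)) =
      fun _ => 0 := by
    funext k
    rw [hit k f hf, zero_div]
  rw [hz] at hp
  have hz2 : (FormalMultilinearSeries.ofScalars ℝ (fun _ : ℕ => (0 : ℝ))) = 0 := by
    ext
    simp [FormalMultilinearSeries.ofScalars]
  rw [hz2] at hp
  have := hga.eqOn_zero_of_preconnected_of_eventuallyEq_zero isPreconnected_univ (mem_univ 0)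
    hp.eventually_eq_zero (mem_univ 1)
  simpa using this

lemma mem_of_Fk {n : ℕ} {s : ℝ} {ν : Measure (Heis n)} (h : Unif ν s) {v : Heis n}
    (hF : ∀ lam > 0, Fk ν lam v = Fk ν lam eH) : v ∈ suppH ν := by
  by_contra hv
  obtain ⟨r, hr, h0⟩ : ∃ r > 0, ν (ballH v r) = 0 := by simpa [suppH] using hv
  have hub : ∀ lam : ℝ, 1 ≤ lam → Fk ν lam v ≤ Real.exp (-(lam - 1) * r ^ 4) * Fk ν 1 v := by
    intro lam hl
    unfold Fk
    rw [← integral_const_mul]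
    refine integral_mono_ae (integrable_Fk h (by linarith) v)
      ((integrable_Fk h one_pos v).const_mul _) ?_
    have hae : ∀ᵐ y ∂ν, y ∉ ballH v r := measure_eq_zero_iff_ae_notMem.1 h0
    filter_upwards [hae] with y hy
    have hd : r ≤ dH v y := by
      simp only [mem_ballH, not_le] at hy
      exact hy.le
    have h4 : r ^ 4 ≤ dH v y ^ 4 := pow_le_pow_left₀ hr.le hd 4
    rw [← Real.exp_add]
    apply Real.exp_le_exp.2
    nlinarith
  have hlb : ∀ lam : ℝ, 0 < lam →
      Real.exp (-lam * (r / 2) ^ 4) * (r / 2) ^ s ≤ Fk ν lam eH := by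
    intro lam hl
    have hr2 : 0 < r / 2 := by positivity
    have hb := h.ball eH h.zero (r / 2) hr2
    have hreal : ν.real (ballH eH (r / 2)) = (r / 2) ^ s := by
      rw [Measure.real, hb, ENNReal.toReal_ofReal (by positivity)]
    have h1 : ∫ y in ballH eH (r / 2), Real.exp (-lam * dH eH y ^ 4) ∂ν ≤ Fk ν lam eH :=
      setIntegral_le_integral (integrable_Fk h hl eH) (ae_of_all _ fun y => (Real.exp_pos _).le)
    refine le_trans ?_ h1
    have hfin : ν (ballH eH (r / 2)) ≠ ⊤ := by rw [hb]; exact ENNReal.ofReal_ne_top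
    have h2 : ∫ y in ballH eH (r / 2), Real.exp (-lam * (r / 2) ^ 4) ∂ν ≤
        ∫ y in ballH eH (r / 2), Real.exp (-lam * dH eH y ^ 4) ∂ν := by
      refine setIntegral_mono_on (integrableOn_const hfin) (integrable_Fk h hl eH).integrableOn
        (measurableSet_ballH _ _) fun y hy => ?_
      apply Real.exp_le_exp.2
      have h4 : dH eH y ^ 4 ≤ (r / 2) ^ 4 := pow_le_pow_left₀ (dH_nonneg _ _) hy 4
      nlinarith
    rw [setIntegral_const, hreal, smul_eq_mul] at h2
    linarith [mul_comm ((r / 2) ^ s) (Real.exp (-lam * (r / 2) ^ 4))]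
  set A := Fk ν 1 v
  have hcomb : ∀ lam : ℝ, 1 ≤ lam →
      (r / 2) ^ s ≤ Real.exp (r ^ 4) * A * Real.exp (-(15 / 16 * r ^ 4 * lam)) := by
    intro lam hl
    have h1 := (hlb lam (by linarith)).trans ((hF lam (by linarith)).symm.le.trans (hub lam hl))
    have h2 := mul_le_mul_of_nonneg_left h1 (Real.exp_pos (lam * (r / 2) ^ 4)).le
    rw [← mul_assoc, ← mul_assoc, ← Real.exp_add, ← Real.exp_add] at h2
    have e1 : lam * (r / 2) ^ 4 + -lam * (r / 2) ^ 4 = 0 := by ring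
    have e2 : lam * (r / 2) ^ 4 + -(lam - 1) * r ^ 4 = r ^ 4 + -(15 / 16 * r ^ 4 * lam) := by ring
    rw [e1, e2, Real.exp_zero, one_mul, Real.exp_add] at h2
    linarith [mul_right_comm (Real.exp (r ^ 4)) A (Real.exp (-(15 / 16 * r ^ 4 * lam)))]
  have hlim : Tendsto (fun lam : ℝ => Real.exp (r ^ 4) * A * Real.exp (-(15 / 16 * r ^ 4 * lam)))
      atTop (𝓝 (Real.exp (r ^ 4) * A * 0)) := by
    refine tendsto_const_nhds.mul (Real.tendsto_exp_neg_atTop_nhds_zero.comp ?_)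
    exact tendsto_id.const_mul_atTop (by positivity)
  rw [mul_zero] at hlim
  have := ge_of_tendsto hlim ((eventually_ge_atTop 1).mono hcomb)
  have h3 : 0 < (r / 2) ^ s := by positivity
  linarith

lemma full_support {n : ℕ} {s : ℝ} (hs : 0 < s) {ν : Measure (Heis n)} (h : Unif ν s) (v : Heis n)
    (hD : ∀ f, InI ν f → InI ν (fun x => Xop v.1 f x + v.2 * Tvert f x)) : v ∈ suppH ν := by
  refine mem_of_Fk h fun lam hl => ?_
  have hI : InI ν (fun x => Fk ν lam x - Fk ν lam eH) :=
    ⟨(contDiff_Fk h hl).sub contDiff_const, fun x hx => by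
      show Fk ν lam x - Fk ν lam eH = 0
      rw [Fk_const hs h lam hx h.zero, sub_self]⟩
  have := line_zero h.zero v hD hI
  linarith

lemma dim_le {n : ℕ} {q s c C c' C' : ℝ} (hc : 0 < c) (hC : 0 < C) (hc' : 0 < c') (hC' : 0 < C')
    (α β : Measure (Heis n)) [SFinite α] [SFinite β] {S : Set (Heis n)}
    (hαS : ∀ᵐ x ∂α, x ∈ S) (hβS : ∀ᵐ x ∂β, x ∈ S) (h0 : eH ∈ S)
    (hβl : ∀ x ∈ S, ∀ r > 0, ENNReal.ofReal (c * r ^ q) ≤ β (ballH x r))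
    (hβu : ∀ x ∈ S, ∀ r > 0, β (ballH x r) ≤ ENNReal.ofReal (C * r ^ q))
    (hαl : ∀ x ∈ S, ∀ r > 0, ENNReal.ofReal (c' * r ^ s) ≤ α (ballH x r))
    (hαu : ∀ x ∈ S, ∀ r > 0, α (ballH x r) ≤ ENNReal.ofReal (C' * r ^ s)) : s ≤ q := by
  have key : ∀ r : ℝ, 0 < r → r ≤ 1 → c * r ^ q * c' ≤ C' * r ^ s * (C * 2 ^ q) := by
    intro r hr hr1
    let D : Set (Heis n × Heis n) := {p | dH p.1 p.2 ≤ r}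
    have hD : MeasurableSet D := (isClosed_le continuous_dH continuous_const).measurableSet
    have hB : MeasurableSet (ballH (eH : Heis n) 1) := measurableSet_ballH _ _
    have e1 := Measure.prod_apply (μ := α.restrict (ballH eH 1)) (ν := β) hD
    have e2 := Measure.prod_apply_symm (μ := α.restrict (ballH eH 1)) (ν := β) hD
    have l1 : ENNReal.ofReal (c * r ^ q) * ENNReal.ofReal c' ≤
        ((α.restrict (ballH eH 1)).prod β) D := by
      rw [e1]
      calc ENNReal.ofReal (c * r ^ q) * ENNReal.ofReal c'
          ≤ ENNReal.ofReal (c * r ^ q) * α (ballH eH 1) := by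
            gcongr
            simpa using hαl eH h0 1 one_pos
        _ = ∫⁻ x in ballH eH 1, ENNReal.ofReal (c * r ^ q) ∂α := by
            rw [setLIntegral_const]
        _ ≤ _ := by
            refine lintegral_mono_ae (ae_restrict_of_ae ?_)
            filter_upwards [hαS] with x hx
            exact hβl x hx r hr
    have l2 : ((α.restrict (ballH eH 1)).prod β) D ≤
        ENNReal.ofReal (C' * r ^ s) * ENNReal.ofReal (C * 2 ^ q) := by
      rw [e2]
      calc ∫⁻ y, (α.restrict (ballH eH 1)) ((fun x => (x, y)) ⁻¹' D) ∂β
          ≤ ∫⁻ y, (ballH eH 2).indicator (fun _ => ENNReal.ofReal (C' * r ^ s)) y ∂β := by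
            refine lintegral_mono_ae ?_
            filter_upwards [hβS] with y hy
            rw [Measure.restrict_apply' hB]
            by_cases hy2 : y ∈ ballH eH 2
            · rw [indicator_of_mem hy2]
              refine le_trans (measure_mono ?_) (hαu y hy r hr)
              rintro x ⟨hx, -⟩
              rw [mem_ballH, dH_comm]
              exact hx
            · rw [indicator_of_notMem hy2, nonpos_iff_eq_zero]
              convert measure_empty (μ := α)
              rw [eq_empty_iff_forall_notMem]
              rintro x ⟨hx, hx1⟩
              apply hy2
              have h1 : dH x y ≤ r := hx
              have h2 : dH eH x ≤ 1 := hx1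
              have := dH_triangle eH x y
              rw [mem_ballH]
              linarith
        _ = ENNReal.ofReal (C' * r ^ s) * β (ballH eH 2) := by
            rw [lintegral_indicator (measurableSet_ballH _ _), setLIntegral_const]
        _ ≤ _ := by
            gcongr
            exact hβu eH h0 2 two_pos
    have l3 := l1.trans l2
    rw [← ENNReal.ofReal_mul (by positivity), ← ENNReal.ofReal_mul (by positivity),
      ENNReal.ofReal_le_ofReal_iff (by positivity)] at l3
    exact l3
  by_contra hlt
  push Not at hlt
  have hlim : Tendsto (fun r : ℝ => C' * C * 2 ^ q * r ^ (s - q)) (𝓝[>] 0) (𝓝 (C' * C * 2 ^ q * 0)) := by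
    refine tendsto_const_nhds.mul ?_
    have : Tendsto (fun r : ℝ => r ^ (s - q)) (𝓝 0) (𝓝 (0 ^ (s - q))) :=
      (Real.continuousAt_rpow_const 0 (s - q) (Or.inr (by linarith))).tendsto
    rw [Real.zero_rpow (by linarith)] at this
    exact this.mono_left nhdsWithin_le_nhds
  rw [mul_zero] at hlim
  have hev : ∀ᶠ r : ℝ in 𝓝[>] 0, c * c' ≤ C' * C * 2 ^ q * r ^ (s - q) := by
    filter_upwards [Ioc_mem_nhdsGT (zero_lt_one (α := ℝ))] with r hr
    have h1 := key r hr.1 hr.2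
    have hrq : 0 < r ^ q := Real.rpow_pos_of_pos hr.1 _
    have h2 : r ^ s = r ^ (s - q) * r ^ q := by
      rw [← Real.rpow_add hr.1]; ring_nf
    rw [h2] at h1
    have h3 : c * c' * r ^ q ≤ C' * C * 2 ^ q * r ^ (s - q) * r ^ q := by linarith
    exact le_of_mul_le_mul_right h3 hrq
  have := ge_of_tendsto hlim hev
  have : 0 < c * c' := by positivity
  linarith

/-- The homogeneous subspaces. -/
def VS {n : ℕ} (W : Submodule ℝ (EE n)) (b : Bool) : Set (Heis n) :=
  {x | x.1 ∈ W ∧ (b = false → x.2 = 0)}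

/-- Homogeneous dimension. -/
def Qd {n : ℕ} (W : Submodule ℝ (EE n)) (b : Bool) : ℝ :=
  Module.finrank ℝ W + (if b then 2 else 0)

lemma exists_model {n : ℕ} (W : Submodule ℝ (EE n)) (b : Bool)
    (hW : b = false → ∀ u ∈ W, ∀ v ∈ W, symp u v = 0) :
    ∃ β : Measure (Heis n), SFinite β ∧ (∀ᵐ x ∂β, x ∈ VS W b) ∧ ∃ c C : ℝ, 0 < c ∧ 0 < C ∧
      (∀ x ∈ VS W b, ∀ r > 0, ENNReal.ofReal (c * r ^ Qd W b) ≤ β (ballH x r)) ∧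
      (∀ x ∈ VS W b, ∀ r > 0, β (ballH x r) ≤ ENNReal.ofReal (C * r ^ Qd W b)) := by
  have hvol : ∀ (a : W) (r : ℝ), 0 < r → volume (Metric.closedBall a r) =
      ENNReal.ofReal (r ^ (Module.finrank ℝ W : ℝ) * (volume (Metric.ball (0 : W) 1)).toReal) := by
    intro a r hr
    rw [Measure.addHaar_closedBall _ a hr.le, ENNReal.ofReal_mul (by positivity),
      ENNReal.ofReal_toReal measure_ball_lt_top.ne, Real.rpow_natCast]
  set m := (volume (Metric.ball (0 : W) 1)).toReal with hm
  have hm0 : 0 < m := ENNReal.toReal_pos (Metric.measure_ball_pos _ _ one_pos).ne'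
    measure_ball_lt_top.ne
  have hdH : ∀ (x : Heis n) (w : EE n) (t : ℝ),
      dH x (w, t) ^ 4 = ‖w - x.1‖ ^ 4 + (t - (x.2 + symp x.1 w)) ^ 2 := by
    intro x w t
    rw [dH, KNorm_pow]
    simp only [hmul, hinv, symp_neg_left]
    rw [neg_add_eq_sub]
    ring_nf
  have hle : ∀ (x y : Heis n) (r : ℝ), 0 < r → (y ∈ ballH x r ↔ dH x y ^ 4 ≤ r ^ 4) := by
    intro x y r hr
    rw [mem_ballH, pow_le_pow_iff_left₀ (dH_nonneg _ _) hr.le (by norm_num)]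
  cases b with
  | false =>
    have hcont : Continuous (fun w : W => ((w : EE n), (0 : ℝ))) := by fun_prop
    have hball : ∀ x ∈ VS W false, ∀ r > 0,
        (volume.map (fun w : W => ((w : EE n), (0 : ℝ)))) (ballH x r) =
        ENNReal.ofReal (m * r ^ Qd W false) := by
      intro x hx r hr
      rw [Measure.map_apply hcont.measurable (measurableSet_ballH _ _)]
      have : (fun w : W => ((w : EE n), (0 : ℝ))) ⁻¹' ballH x r =
          Metric.closedBall (⟨x.1, hx.1⟩ : W) r := by
        ext w
        have hx2 : x.2 = 0 := hx.2 rfl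
        have hxw : symp x.1 (w : EE n) = 0 := hW rfl _ hx.1 _ w.2
        rw [mem_preimage, hle _ _ _ hr, hdH, hxw, Metric.mem_closedBall, dist_eq_norm]
        simp only [hx2, add_zero, sub_zero, ne_eq, OfNat.ofNat_ne_zero, not_false_eq_true, zero_pow]
        rw [pow_le_pow_iff_left₀ (norm_nonneg _) hr.le (by norm_num)]
        rfl
      rw [this, hvol _ _ hr, mul_comm]
      simp [Qd]
    refine ⟨volume.map (fun w : W => ((w : EE n), (0 : ℝ))), inferInstance, ?_, m, m, hm0, hm0,
      fun x hx r hr => (hball x hx r hr).ge, fun x hx r hr => (hball x hx r hr).le⟩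
    have hcl : MeasurableSet (VS W false) := by
      have : VS W false = (W : Set (EE n)) ×ˢ {0} := by ext; simp [VS]
      rw [this]
      exact (W.closed_of_finiteDimensional.prod isClosed_singleton).measurableSet
    refine (ae_map_iff hcont.aemeasurable hcl).2 ?_
    exact ae_of_all _ fun w => ⟨w.2, fun _ => rfl⟩
  | true =>
    have hcont : Continuous (fun p : W × ℝ => ((p.1 : EE n), p.2)) := by fun_prop
    have hQ : ∀ r : ℝ, 0 < r → r ^ Qd W true = r ^ (Module.finrank ℝ W : ℝ) * r ^ 2 := by
      intro r hr
      simp only [Qd, if_true]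
      rw [Real.rpow_add hr]
      norm_num
    have hsl : ∀ (x : Heis n) (r : ℝ), ((volume : Measure (W × ℝ)).map
        (fun p : W × ℝ => ((p.1 : EE n), p.2))) (ballH x r) =
        ∫⁻ w : W, volume {t : ℝ | ((w : EE n), t) ∈ ballH x r} := by
      intro x r
      rw [Measure.map_apply hcont.measurable (measurableSet_ballH _ _), Measure.volume_eq_prod,
        Measure.prod_apply (hcont.measurable (measurableSet_ballH _ _))]
      rfl
    refine ⟨volume.map (fun p : W × ℝ => ((p.1 : EE n), p.2)), inferInstance, ?_,
      m * (1 / 2) ^ (Module.finrank ℝ W : ℝ), 2 * m, by positivity, by positivity,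
      fun x hx r hr => ?_, fun x hx r hr => ?_⟩
    · have hcl : MeasurableSet (VS W true) := by
        have : VS W true = (W : Set (EE n)) ×ˢ univ := by ext; simp [VS]
        rw [this]
        exact (W.closed_of_finiteDimensional.prod isClosed_univ).measurableSet
      refine (ae_map_iff hcont.aemeasurable hcl).2 ?_
      exact ae_of_all _ fun w => ⟨w.1.2, fun h => by simp at h⟩
    · rw [hsl]
      calc ENNReal.ofReal (m * (1 / 2) ^ (Module.finrank ℝ W : ℝ) * r ^ Qd W true)
          = ENNReal.ofReal (r ^ 2) * volume (Metric.closedBall (⟨x.1, hx.1⟩ : W) (r / 2)) := by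
            rw [hvol _ _ (by positivity), ← ENNReal.ofReal_mul (by positivity), hQ r hr,
              div_eq_mul_inv r 2, Real.mul_rpow hr.le (by norm_num), one_div]
            ring_nf
        _ = ∫⁻ w : W, (Metric.closedBall (⟨x.1, hx.1⟩ : W) (r / 2)).indicator
              (fun _ => ENNReal.ofReal (r ^ 2)) w := by
            rw [lintegral_indicator Metric.isClosed_closedBall.measurableSet, setLIntegral_const]
        _ ≤ _ := by
            refine lintegral_mono fun w => ?_
            by_cases hw : w ∈ Metric.closedBall (⟨x.1, hx.1⟩ : W) (r / 2)
            · rw [indicator_of_mem hw]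
              have e : ENNReal.ofReal (r ^ 2) =
                  volume (Metric.closedBall (x.2 + symp x.1 (w : EE n)) (r ^ 2 / 2)) := by
                rw [Real.volume_closedBall]; ring_nf
              rw [e]
              refine measure_mono fun t ht => ?_
              show ((w : EE n), t) ∈ ballH x r
              rw [hle _ _ _ hr, hdH]
              have h1 : ‖(w : EE n) - x.1‖ ≤ r / 2 := by
                rw [Metric.mem_closedBall, dist_eq_norm] at hw
                exact hw
              have h2 : |t - (x.2 + symp x.1 (w : EE n))| ≤ r ^ 2 / 2 := by
                rwa [Metric.mem_closedBall, Real.dist_eq] at ht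
              have h3 := pow_le_pow_left₀ (norm_nonneg _) h1 4
              have h4 := pow_le_pow_left₀ (abs_nonneg _) h2 2
              rw [sq_abs] at h4
              have h5 : 0 < r ^ 4 := by positivity
              nlinarith
            · rw [indicator_of_notMem hw]
              exact zero_le
    · rw [hsl]
      calc _ ≤ ∫⁻ w : W, (Metric.closedBall (⟨x.1, hx.1⟩ : W) r).indicator
              (fun _ => ENNReal.ofReal (2 * r ^ 2)) w := by
            refine lintegral_mono fun w => ?_
            by_cases hw : w ∈ Metric.closedBall (⟨x.1, hx.1⟩ : W) r
            · rw [indicator_of_mem hw]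
              have e : ENNReal.ofReal (2 * r ^ 2) =
                  volume (Metric.closedBall (x.2 + symp x.1 (w : EE n)) (r ^ 2)) := by
                rw [Real.volume_closedBall]
              rw [e]
              refine measure_mono fun t ht => ?_
              have ht' : ((w : EE n), t) ∈ ballH x r := ht
              rw [hle _ _ _ hr, hdH] at ht'
              rw [Metric.mem_closedBall, Real.dist_eq]
              have h5 : 0 ≤ ‖(w : EE n) - x.1‖ ^ 4 := by positivity
              apply abs_le_of_sq_le_sq _ (by positivity)
              nlinarith
            · rw [indicator_of_notMem hw, nonpos_iff_eq_zero]
              convert measure_empty (μ := (volume : Measure ℝ))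
              rw [eq_empty_iff_forall_notMem]
              intro t ht
              have ht' : ((w : EE n), t) ∈ ballH x r := ht
              rw [hle _ _ _ hr, hdH] at ht'
              apply hw
              rw [Metric.mem_closedBall, dist_eq_norm]
              show ‖(w : EE n) - x.1‖ ≤ r
              rw [← pow_le_pow_iff_left₀ (norm_nonneg _) hr.le (four_ne_zero)]
              nlinarith [sq_nonneg (t - (x.2 + symp x.1 (w : EE n)))]
        _ = ENNReal.ofReal (2 * r ^ 2) * volume (Metric.closedBall (⟨x.1, hx.1⟩ : W) r) := by
            rw [lintegral_indicator Metric.isClosed_closedBall.measurableSet, setLIntegral_const]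
        _ = _ := by
            rw [hvol _ _ hr, ← ENNReal.ofReal_mul (by positivity), hQ r hr]
            ring_nf

lemma dim_eq {n : ℕ} {s : ℝ} {ν : Measure (Heis n)} (h : Unif ν s)
    (W : Submodule ℝ (EE n)) (b : Bool) (hW : b = false → ∀ u ∈ W, ∀ v ∈ W, symp u v = 0)
    (hS : suppH ν = VS W b) : s = Qd W b := by
  obtain ⟨β, hβ, hβS, c, C, hc, hC, hl, hu⟩ := exists_model W b hW
  have := h.finite
  have hνS : ∀ᵐ x ∂ν, x ∈ VS W b := by
    rw [← hS]
    exact measure_compl_suppH ν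
  have h0 : eH ∈ VS W b := hS ▸ h.zero
  have hνl : ∀ x ∈ VS W b, ∀ r > 0, ENNReal.ofReal (1 * r ^ s) ≤ ν (ballH x r) := by
    intro x hx r hr
    rw [h.ball x (hS ▸ hx) r hr, one_mul]
  have hνu : ∀ x ∈ VS W b, ∀ r > 0, ν (ballH x r) ≤ ENNReal.ofReal (1 * r ^ s) := by
    intro x hx r hr
    rw [h.ball x (hS ▸ hx) r hr, one_mul]
  exact le_antisymm
    (dim_le hc hC one_pos one_pos ν β hνS hβS h0 hl hu hνl hνu)
    (dim_le one_pos one_pos hc hC β ν hβS hνS h0 hνl hνu hl hu)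

/-- Induction predicate. -/
def Good {n : ℕ} (s : ℝ) (W : Submodule ℝ (EE n)) (b : Bool) : Prop :=
  (b = false → ∀ u ∈ W, ∀ v ∈ W, symp u v = 0) ∧ ∃ ν : Measure (Heis n), Unif ν s ∧
    suppH ν ⊆ VS W b

lemma VS_cancel {n : ℕ} {W : Submodule ℝ (EE n)} {b : Bool}
    (hW : b = false → ∀ u ∈ W, ∀ v ∈ W, symp u v = 0) {x k : Heis n} {r : ℝ} (hr : 0 < r)
    (hx : x ∈ VS W b) (h : hmul x (dil r k) ∈ VS W b) : k ∈ VS W b := by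
  have h1 : x.1 + r • k.1 ∈ W := h.1
  have h2 : r • k.1 ∈ W := (W.add_mem_iff_right hx.1).1 h1
  have h3 : k.1 ∈ W := (W.smul_mem_iff hr.ne').1 h2
  refine ⟨h3, fun hb => ?_⟩
  have h4 : x.2 + r ^ 2 * k.2 + symp x.1 (r • k.1) = 0 := h.2 hb
  rw [hx.2 hb, hW hb _ hx.1 _ h2, zero_add, add_zero] at h4
  simpa [hr.ne'] using h4

lemma isClosed_VS {n : ℕ} (W : Submodule ℝ (EE n)) (b : Bool) : IsClosed (VS W b) := by
  have hW := W.closed_of_finiteDimensional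
  cases b with
  | false =>
    have : VS W false = (W : Set (EE n)) ×ˢ {0} := by ext; simp [VS]
    rw [this]
    exact hW.prod isClosed_singleton
  | true =>
    have : VS W true = (W : Set (EE n)) ×ˢ univ := by ext; simp [VS]
    rw [this]
    exact hW.prod isClosed_univ

lemma tangent_VS {n : ℕ} {s : ℝ} (hs : 0 < s) {ν : Measure (Heis n)} (h : Unif ν s)
    {W : Submodule ℝ (EE n)} {b : Bool} (hW : b = false → ∀ u ∈ W, ∀ v ∈ W, symp u v = 0)
    (hS : suppH ν ⊆ VS W b) {x : Heis n} (hx : x ∈ suppH ν) :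
    ∃ ν' : Measure (Heis n), Unif ν' s ∧ ∀ y ∈ suppH ν', y ∈ VS W b ∧
      ∃ (r : ℕ → ℝ) (k : ℕ → Heis n), TSeq ν x y r k ∧ ∀ m, k m ∈ VS W b := by
  obtain ⟨ν', h', ht⟩ := tangent hs h hx
  refine ⟨ν', h', fun y hy => ?_⟩
  obtain ⟨r, k, hr, hr0, hk, hm⟩ := ht y hy
  have hkV : ∀ m, k m ∈ VS W b := fun m => VS_cancel hW (hr m) (hS hx) (hS (hm m))
  exact ⟨(isClosed_VS W b).mem_of_tendsto hk (Eventually.of_forall hkV), r, k,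
    ⟨hr, hr0, hk, hm⟩, hkV⟩

/-- The functional `w ↦ X_w f (x)`. -/
def Xlin {n : ℕ} (f : Heis n → ℝ) (x : Heis n) : EE n →ₗ[ℝ] ℝ where
  toFun w := Xop w f x
  map_add' u v := by
    have : ((u + v, symp x.1 (u + v)) : Heis n) = (u, symp x.1 u) + (v, symp x.1 v) := by
      simp [symp_add_right]
    simp only [Xop]
    rw [this, map_add]
  map_smul' c u := by
    have : ((c • u, symp x.1 (c • u)) : Heis n) = c • (u, symp x.1 u) := by
      simp [symp_smul_right]
    simp only [Xop]
    rw [this, map_smul]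
    rfl

lemma descent_step {n : ℕ} {s : ℝ} (hs : 0 < s) (W : Submodule ℝ (EE n)) (b : Bool)
    (hG : Good s W b) : s = Qd W b ∨
      (∃ W' : Submodule ℝ (EE n), Module.finrank ℝ W' < Module.finrank ℝ W ∧ Good s W' b) ∨
      (b = true ∧ Good s W false) := by
  obtain ⟨hW, ν, h, hS⟩ := hG
  by_cases hA : ∃ f, InI ν f ∧ ∃ x ∈ suppH ν, ∃ w ∈ W, Xop w f x ≠ 0
  · right; left
    obtain ⟨f, hf, x, hx, w, hw, hne⟩ := hA
    obtain ⟨ν', h', ht⟩ := tangent_VS hs h hW hS hx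
    refine ⟨W ⊓ LinearMap.ker (Xlin f x), ?_, fun hb u hu v hv => hW hb u hu.1 v hv.1, ν', h',
      fun y hy => ?_⟩
    · apply Submodule.finrank_lt_finrank_of_lt
      refine lt_of_le_of_ne inf_le_left fun he => hne ?_
      have : w ∈ W ⊓ LinearMap.ker (Xlin f x) := he.symm.le hw
      exact this.2
    · obtain ⟨hyV, r, k, hT, -⟩ := ht y hy
      exact ⟨⟨hyV.1, tangent_first hf hx hT⟩, hyV.2⟩
  push Not at hA
  have hX : ∀ f, InI ν f → ∀ w ∈ W, InI ν (Xop w f) := fun f hf w hw =>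
    ⟨contDiff_Xop hf.1 w, fun x hx => hA f hf x hx w hw⟩
  by_cases hB : b = true ∧ ∃ f, InI ν f ∧ ∃ x ∈ suppH ν, Tvert f x ≠ 0
  · right; right
    obtain ⟨hb, f, hf, x, hx, hne⟩ := hB
    refine ⟨hb, fun _ u hu v hv => ?_, ?_⟩
    · have hc := Xop_comm hf.1 u v x
      rw [(hX _ (hX f hf v hv) u hu).2 x hx, (hX _ (hX f hf u hu) v hv).2 x hx, sub_zero] at hc
      have : symp u v * Tvert f x = 0 := by linarith
      exact (mul_eq_zero.1 this).resolve_right hne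
    · obtain ⟨ν', h', ht⟩ := tangent_VS hs h hW hS hx
      refine ⟨ν', h', fun y hy => ?_⟩
      obtain ⟨hyV, r, k, hT, hk⟩ := ht y hy
      refine ⟨hyV.1, fun _ => ?_⟩
      have := tangent_second hf (hX f hf) (fun w hw => hX _ (hX f hf w hw) w hw) hx hT
        (fun m => (hk m).1) hyV.1
      exact (mul_eq_zero.1 this).resolve_right hne
  · left
    refine dim_eq h W b hW (Subset.antisymm hS fun v hv => full_support hs h v fun f hf => ?_)
    refine ⟨(contDiff_Xop hf.1 _).add (contDiff_const.mul (contDiff_Tvert hf.1)), fun x hx => ?_⟩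
    show Xop v.1 f x + v.2 * Tvert f x = 0
    rw [hA f hf x hx v.1 hv.1, zero_add]
    cases hb : b with
    | false => rw [hv.2 hb, zero_mul]
    | true =>
      have : Tvert f x = 0 := by
        by_contra hne
        exact hB ⟨hb, f, hf, x, hx, hne⟩
      rw [this, mul_zero]

lemma descent {n : ℕ} {s : ℝ} (hs : 0 < s) : ∀ (N : ℕ) (W : Submodule ℝ (EE n)) (b : Bool),
    Module.finrank ℝ W + (if b then 1 else 0) ≤ N → Good s W b →
    ∃ (W' : Submodule ℝ (EE n)) (b' : Bool), s = Qd W' b' := by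
  intro N
  induction N with
  | zero =>
    intro W b hN hG
    rcases descent_step hs W b hG with h | ⟨W', hlt, hG'⟩ | ⟨hb, hG'⟩
    · exact ⟨W, b, h⟩
    · omega
    · simp [hb] at hN
  | succ N ih =>
    intro W b hN hG
    rcases descent_step hs W b hG with h | ⟨W', hlt, hG'⟩ | ⟨hb, hG'⟩
    · exact ⟨W, b, h⟩
    · exact ih W' b (by omega) hG'
    · refine ih W false ?_ hG'
      simp only [hb, if_true] at hN
      simp only [Bool.false_eq_true, if_false]
      omega

theorem main_thm (n : ℕ) (s : ℝ) (hs : 0 < s)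
    (μ : Measure (Heis n)) [μ.Regular]
    (h : 0 < μ {x : Heis n | ∃ d : ℝ≥0∞, 0 < d ∧ d < ⊤ ∧ HasDensity μ s x d}) :
    ∃ k : ℤ, s = k := by
  obtain ⟨ν, hν⟩ := exists_unif hs μ h
  obtain ⟨W, b, hQ⟩ := descent hs _ (⊤ : Submodule ℝ (EE n)) true le_rfl
    ⟨fun hb => by simp at hb, ν, hν, fun x _ => ⟨Submodule.mem_top, fun hb => by simp at hb⟩⟩
  cases b with
  | false => exact ⟨Module.finrank ℝ W, by rw [hQ]; simp [Qd]⟩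
  | true => exact ⟨Module.finrank ℝ W + 2, by rw [hQ]; simp [Qd]⟩

/-- **Marstrand's density theorem in the Heisenberg group.**
If `μ` is a Radon measure on `(ℍⁿ, d_H)` such that the set of points where the `s`-density
exists and is positive and finite has positive `μ`-measure, then `s` is an integer. -/
theorem statement0 (n : ℕ) (hn : 1 ≤ n) (s : ℝ) (hs : 0 < s)
    (μ : Measure (Heis n)) [μ.Regular]
    (h : 0 < μ {x : Heis n | ∃ d : ℝ≥0∞, 0 < d ∧ d < ⊤ ∧ HasDensity μ s x d}) :
    ∃ k : ℤ, s = k :=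
  main_thm n s hs μ h
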